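/- arXiv:2105.13216 — 3 statements merged into one kernel-verified Lean document; each statement's English description precedes it below -/
import Mathlib

section
/- Suppose 1 ≤ m < s. Then every minimal norm pair of length m extends to a minimal norm pair of length s, and every minimal norm pair of length s is the extension of a minimal norm pair of length m. -/
/-!
Common setup.  Throughout, `K/F` is a cyclic Galois extension of degree `p^n`
with Galois group `G = Gal(K/F)` generated by `σ`.  For `0 ≤ i ≤ n`, `K_i`
denotes the intermediate field of degree `p^i` over `F`, realized here via its
unit group `KiU p σ i` (the units of `K` fixed by `σ^{p^i}`), and
`G_i = Gal(K_i/F)`.  For `m ≥ 1`, `R_m = ℤ/p^m` and `J_m = K^×/K^{×p^m}`.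
-/

namespace MSS

variable {F K : Type*} [Field F] [Field K] [Algebra F K]

/-- Action of a field automorphism on the unit group. -/
def umap (σ : K ≃ₐ[F] K) : Kˣ →* Kˣ := Units.map (σ : K →* K)

/-- The norm from `K_j` to `F`, computed in `K` as the product of conjugates
`∏_{k < p^j} σ^k(γ)` (valid for `γ ∈ K_j`). -/
noncomputable def normHom (p : ℕ) (σ : K ≃ₐ[F] K) (j : ℕ) : Kˣ →* Kˣ :=
  ∏ k ∈ Finset.range (p ^ j), umap (σ ^ k)

/-- The unit group of the intermediate field `K_i`: the units fixed by `σ^{p^i}`. -/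
def KiU (p : ℕ) (σ : K ≃ₐ[F] K) (i : ℕ) : Subgroup Kˣ :=
  (umap (σ ^ p ^ i) / MonoidHom.id Kˣ).ker

/-- Membership in `K_a^×` for a level `a ∈ {-∞, 0, 1, …}`; level `-∞` means
the trivial group `{1}`. -/
def levelMem (p : ℕ) (σ : K ≃ₐ[F] K) (a : WithBot ℕ) (γ : Kˣ) : Prop :=
  WithBot.recBotCoe (γ = 1) (fun i => γ ∈ KiU p σ i) a

/-- `(α, δ)` represents the pair `(a, d)`:  `σ(α)·α^{-d} = ∏_{i=0}^m δ_i^{p^i}` with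
`δ_i ∈ K_{a_i}^×` for `i < m`, and
`ξ_p = N_{K/F}(α)^{(d-1)/p} · N_{K_{n-1}/F}(δ_0) · ∏_{i=1}^m N_{K/F}(δ_i)^{p^{i-1}}`. -/
noncomputable def Represents (p n : ℕ) (σ : K ≃ₐ[F] K) (ξ : Kˣ) {m : ℕ}
    (a : Fin m → WithBot ℕ) (d : ℤ) (α : Kˣ) (δ : ℕ → Kˣ) : Prop :=
  (∀ i : Fin m, levelMem p σ (a i) (δ i)) ∧
  umap σ α = α ^ d * ∏ i ∈ Finset.range (m + 1), δ i ^ p ^ i ∧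
  ξ = normHom p σ n α ^ ((d - 1) / (p : ℤ)) * normHom p σ (n - 1) (δ 0) *
      ∏ i ∈ Finset.Icc 1 m, normHom p σ n (δ i) ^ p ^ (i - 1)

/-- `(a, d)` is a norm pair of length `m`: `a ∈ {-∞,0,…,n}^m` with `a_0 < n`,
`d ∈ U_1`, and some `(α, δ)` represents `(a, d)`. -/
noncomputable def IsNormPair (p n : ℕ) (σ : K ≃ₐ[F] K) (ξ : Kˣ) {m : ℕ}
    (a : Fin m → WithBot ℕ) (d : ℤ) : Prop :=
  (∀ i, a i ≤ (n : WithBot ℕ)) ∧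
  (∀ h0 : 0 < m, a ⟨0, h0⟩ < (n : WithBot ℕ)) ∧
  (p : ℤ) ∣ d - 1 ∧
  ∃ (α : Kˣ) (δ : ℕ → Kˣ), Represents p n σ ξ a d α δ

/-- Strict lexicographic order on norm vectors (with `-∞` smallest). -/
def vecLT {m : ℕ} (a a' : Fin m → WithBot ℕ) : Prop :=
  ∃ k : Fin m, (∀ j : Fin m, j < k → a j = a' j) ∧ a k < a' k

/-- The order `d ≤_m d'` on twists: `d' ∈ U_i → d ∈ U_i` for `1 ≤ i ≤ m`, except
when `p = 2` and `d, d' ∉ U_2`, in which case `d' ∈ -U_i → d ∈ -U_i` for `2 ≤ i ≤ m`. -/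
def twistLE (p m : ℕ) (d d' : ℤ) : Prop :=
  ((p = 2 ∧ ¬ (4 : ℤ) ∣ (d - 1) ∧ ¬ (4 : ℤ) ∣ (d' - 1)) →
    ∀ i : ℕ, 2 ≤ i → i ≤ m → ((2 : ℤ) ^ i ∣ (d' + 1)) → ((2 : ℤ) ^ i ∣ (d + 1))) ∧
  (¬ (p = 2 ∧ ¬ (4 : ℤ) ∣ (d - 1) ∧ ¬ (4 : ℤ) ∣ (d' - 1)) →
    ∀ i : ℕ, 1 ≤ i → i ≤ m → ((p : ℤ) ^ i ∣ (d' - 1)) → ((p : ℤ) ^ i ∣ (d - 1)))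

/-- The order `⪯_m` on norm pairs of length `m`. -/
def pairLE (p : ℕ) {m : ℕ} (a : Fin m → WithBot ℕ) (d : ℤ)
    (a' : Fin m → WithBot ℕ) (d' : ℤ) : Prop :=
  vecLT a a' ∨ (a = a' ∧ twistLE p m d d')

/-- `(a, d)` is a minimal norm pair of length `m`. -/
noncomputable def IsMinimalNormPair (p n : ℕ) (σ : K ≃ₐ[F] K) (ξ : Kˣ) {m : ℕ}
    (a : Fin m → WithBot ℕ) (d : ℤ) : Prop :=
  IsNormPair p n σ ξ a d ∧
  ∀ (a' : Fin m → WithBot ℕ) (d' : ℤ), IsNormPair p n σ ξ a' d' → pairLE p a d a' d'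

/-- `α` is an `m`-exceptional element. -/
noncomputable def IsExceptional (p n : ℕ) (σ : K ≃ₐ[F] K) (ξ : Kˣ) (m : ℕ) (α : Kˣ) : Prop :=
  ∃ (a : Fin m → WithBot ℕ) (d : ℤ) (δ : ℕ → Kˣ),
    IsMinimalNormPair p n σ ξ a d ∧ Represents p n σ ξ a d α δ

/-- The subgroup of `q`-th powers in `K^×`. -/
def powSub (K : Type*) [Field K] (q : ℕ) : Subgroup Kˣ := (powMonoidHom q : Kˣ →* Kˣ).range

/-- The class of a unit in `J_q := K^×/K^{×q}`. -/
def jcls (q : ℕ) (γ : Kˣ) : Kˣ ⧸ powSub K q := QuotientGroup.mk γ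

/-- The action of a field automorphism on `J_q = K^×/K^{×q}`. -/
noncomputable def jmap (q : ℕ) (τ : K ≃ₐ[F] K) : (Kˣ ⧸ powSub K q) →* Kˣ ⧸ powSub K q :=
  QuotientGroup.map _ _ (umap τ) (by
    rintro x ⟨y, rfl⟩
    exact ⟨umap τ y, by simp [powMonoidHom, map_pow]⟩)

/-- The natural map `J_q → J_{q'}` when `q' ∣ q`. -/
noncomputable def resMap (q q' : ℕ) (h : q' ∣ q) : (Kˣ ⧸ powSub K q) →* Kˣ ⧸ powSub K q' :=
  QuotientGroup.map _ _ (MonoidHom.id Kˣ) (by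
    rintro x ⟨y, rfl⟩
    obtain ⟨c, rfl⟩ := h
    exact ⟨y ^ c, by simp [powMonoidHom, ← pow_mul, mul_comm]⟩)

/-- The `R_m[G]`-submodule of `J_q` generated by the classes of the elements of `S`:
the subgroup generated by all `σ^k`-conjugates of classes of elements of `S`. -/
noncomputable def galSpan (q : ℕ) (σ : K ≃ₐ[F] K) (S : Set Kˣ) : Subgroup (Kˣ ⧸ powSub K q) :=
  Subgroup.closure {x | ∃ γ ∈ S, ∃ k : ℕ, x = jcls q (umap (σ ^ k) γ)}

/-- The subgroup `(σ-1)J_q` of `J_q`. -/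
noncomputable def augSub (q : ℕ) (σ : K ≃ₐ[F] K) : Subgroup (Kˣ ⧸ powSub K q) :=
  Subgroup.closure {x | ∃ y : Kˣ ⧸ powSub K q, x = jmap q σ y * y⁻¹}

/-- The cyclic `F_p[G]`-submodule of `J_1 = K^×/K^{×p}` generated by `[γ]_1` is a
free `F_p[G_i]`-module (on the generator `[γ]_1`): `[γ]_1` is fixed by `σ^{p^i}`
and the conjugates `σ^k [γ]_1`, `k < p^i`, are `F_p`-linearly independent. -/
noncomputable def FreeCyc (p : ℕ) (σ : K ≃ₐ[F] K) (i : ℕ) (γ : Kˣ) : Prop :=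
  jcls p (umap (σ ^ p ^ i) γ) = jcls p γ ∧
  ∀ c : Fin (p ^ i) → ZMod p,
    (∏ k : Fin (p ^ i), jcls p (umap (σ ^ (k : ℕ)) γ) ^ (c k).val) = 1 → c = 0

/-- An (indexed) internal direct sum decomposition of a commutative group. -/
def IsDirectSumDecomp {G : Type*} [CommGroup G] {ι : Sort*} (f : ι → Subgroup G) : Prop :=
  iSupIndep f ∧ (⨆ i, f i) = ⊤

/-- The subgroup `F^×` of `K^×` (units coming from the base field). -/
def Funits (F : Type*) {K : Type*} [Field F] [Field K] [Algebra F K] : Subgroup Kˣ :=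
  (Units.map (algebraMap F K : F →* K)).range

/-- The subgroup `F^{×p}` of `K^×`. -/
def FpPow (F : Type*) {K : Type*} [Field F] [Field K] [Algebra F K] (p : ℕ) : Subgroup Kˣ :=
  (Funits F).map (powMonoidHom p)

/-- The subgroup `N_{K_i/F}(K_i^×)` of `K^×`. -/
noncomputable def NormSub (p : ℕ) (σ : K ≃ₐ[F] K) (i : ℕ) : Subgroup Kˣ :=
  (KiU p σ i).map (normHom p σ i)

/-- The subgroup `N_{K_i/F}(K_i^×)·F^{×p}` of `K^×`. -/
noncomputable def NiF (p : ℕ) (σ : K ≃ₐ[F] K) (i : ℕ) : Subgroup Kˣ :=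
  NormSub p σ i ⊔ FpPow F p

/-- The `F_p`-dimension of an (elementary abelian `p`-) commutative group `Q`,
computed as the rank of `F_p ⊗_ℤ Q`. -/
noncomputable def fpdim (p : ℕ) (Q : Type*) [CommGroup Q] : Cardinal :=
  Module.rank (ZMod p) (TensorProduct ℤ (ZMod p) (Additive Q))

/-- The invariant `e_i(K/F)`: for `i < n` the `F_p`-dimension of
`N_{K_i/F}(K_i^×)F^{×p} / N_{K_{i+1}/F}(K_{i+1}^×)F^{×p}`, and for `i = n` the
`F_p`-dimension of `N_{K/F}(K^×)F^{×p}/F^{×p}`. -/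
noncomputable def eKF (p n : ℕ) (σ : K ≃ₐ[F] K) (i : ℕ) : Cardinal :=
  if i < n then
    fpdim p ((NiF p σ i) ⧸ (NiF p σ (i + 1)).subgroupOf (NiF p σ i))
  else
    fpdim p ((NiF p σ n) ⧸ (FpPow F p).subgroupOf (NiF p σ n))

/-- The group ring `R_m[G_i] = (ℤ/p^m)[ℤ/p^i]` (for the cyclic group `G_i` of order
`p^i`). -/
abbrev CycGR (p m i : ℕ) : Type :=
  MonoidAlgebra (ZMod (p ^ m)) (Multiplicative (ZMod (p ^ i)))

/-- The image of the generator `σ` of `G_i` in the group ring `R_m[G_i]`. -/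
noncomputable def gen (p m i : ℕ) : CycGR p m i :=
  MonoidAlgebra.of _ _ (Multiplicative.ofAdd (1 : ZMod (p ^ i)))

/-- Standard basis vector of the free `R_m[G]`-module on generators `e_0, …, e_m`. -/
noncomputable def sing (p n m : ℕ) (j : Fin (m + 1)) (c : CycGR p m n) :
    Fin (m + 1) → CycGR p m n :=
  Pi.single j c

/-- The relations defining the module `X_{a,d,m}`: on generators `y = e_0` and
`x_i = e_{i+1}` (`0 ≤ i < m`), we impose `(σ - d)·y = Σ_i p^i x_i`, and
`(σ^{p^{a_i}} - 1)·x_i = 0` when `a_i ≠ -∞`, resp. `x_i = 0` when `a_i = -∞`. -/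
noncomputable def XRels (p n m : ℕ) (a : Fin m → WithBot ℕ) (d : ℤ) :
    Set (Fin (m + 1) → CycGR p m n) :=
  insert
    (sing p n m 0 (gen p m n - (d : ZMod (p ^ m)) • 1) -
      ∑ i : Fin m, sing p n m i.succ ((p : CycGR p m n) ^ (i : ℕ)))
    {r | ∃ i : Fin m, r = sing p n m i.succ
      (WithBot.recBotCoe (1 : CycGR p m n) (fun k => gen p m n ^ p ^ k - 1) (a i))}

/-- The `R_m[G]`-module `X_{a,d,m}`. -/
noncomputable abbrev Xadm (p n m : ℕ) (a : Fin m → WithBot ℕ) (d : ℤ) :=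
  (Fin (m + 1) → CycGR p m n) ⧸ Submodule.span (CycGR p m n) (XRels p n m a d)

/-- Indecomposability of a module. -/
def IsIndecomposable (R M : Type*) [Ring R] [AddCommGroup M] [Module R M] : Prop :=
  (⊤ : Submodule R M) ≠ ⊥ ∧
  ∀ S T : Submodule R M, S ⊓ T = ⊥ → S ⊔ T = ⊤ → S = ⊥ ∨ T = ⊥

end MSS

namespace MSS

/-- `(a', d')` (a norm pair of length `s`) extends `(a, d)` (of length `m ≤ s`):
the vectors agree in the first `m` coordinates, and `d ≤_m d' ≤_m d`. -/
def ExtendsNP (p : ℕ) {m s : ℕ} (hms : m ≤ s) (a : Fin m → WithBot ℕ) (d : ℤ)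
    (a' : Fin s → WithBot ℕ) (d' : ℤ) : Prop :=
  (∀ j : Fin m, a' (Fin.castLE hms j) = a j) ∧ twistLE p m d d' ∧ twistLE p m d' d

end MSS

universe u v

/-! ### Norm operators on a module with a distinguished operator -/

namespace CyclicNorm

open Finset

section Operators

variable {R A : Type*} [CommRing R] [AddCommGroup A] [Module R A]

/-- The geometric sum `1 + x + ⋯ + x^(q-1)`. -/
def geom (x : R) (q : ℕ) : R := ∑ k ∈ range q, x ^ k

lemma sub_one_mul_geom (x : R) (q : ℕ) : (x - 1) * geom x q = x ^ q - 1 :=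
  mul_geom_sum x q

lemma geom_mul (x : R) (q r : ℕ) : geom x (q * r) = geom x q * geom (x ^ q) r := by
  induction r with
  | zero => simp [geom]
  | succ r ih =>
    have h : geom x (q * (r + 1)) = geom x (q * r) + x ^ (q * r) * geom x q := by
      simp only [geom, mul_sum, Nat.mul_succ, sum_range_add, pow_add]
    have h' : geom (x ^ q) (r + 1) = geom (x ^ q) r + (x ^ q) ^ r := by
      simp [geom, sum_range_succ]
    rw [h, h', ih, pow_mul]
    ring

lemma sub_one_dvd_geom_sub (x : R) (q : ℕ) : x - 1 ∣ geom x q - (q : R) := by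
  have h : geom x q - (q : R) = ∑ k ∈ range q, (x ^ k - 1) := by
    simp [geom]
  rw [h]
  exact dvd_sum fun k _ => sub_one_dvd_pow_sub_one x k

lemma pow_smul_of_fixed {g : R} {x : A} (h : g • x = x) (k : ℕ) : g ^ k • x = x := by
  induction k with
  | zero => simp
  | succ k ih => rw [pow_succ, mul_smul, h, ih]

lemma geom_smul_of_fixed {g : R} {x : A} (h : g • x = x) (q : ℕ) :
    geom g q • x = (q : R) • x := by
  obtain ⟨c, hc⟩ := sub_one_dvd_geom_sub g q
  have h1 : geom g q = (q : R) + c * (g - 1) := by linear_combination hc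
  rw [h1, add_smul, mul_smul, sub_smul, h, one_smul, sub_self, smul_zero, add_zero]

/-- `x` is fixed by `s^(p^b)`, that is, `x` has level at most `b`. -/
def Fix (p : ℕ) (s : R) (b : ℕ) (x : A) : Prop := s ^ p ^ b • x = x

/-- The norm operator from level `c` to level `b`. -/
def relNorm (p : ℕ) (s : R) (b c : ℕ) : R := geom (s ^ p ^ b) (p ^ (c - b))

/-- The norm operator from level `c` to level `0`. -/
def norm (p : ℕ) (s : R) (c : ℕ) : R := geom s (p ^ c)

variable {p : ℕ} {s : R} {b c e n i : ℕ} {x y : A}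

lemma Fix.mono (h : Fix p s b x) (hbc : b ≤ c) : Fix p s c x := by
  have h1 : p ^ c = p ^ b * p ^ (c - b) := by rw [← pow_add, Nat.add_sub_cancel' hbc]
  rw [Fix, h1, pow_mul]
  exact pow_smul_of_fixed h _

lemma Fix.add (hx : Fix p s b x) (hy : Fix p s b y) : Fix p s b (x + y) := by
  rw [Fix] at *; rw [smul_add, hx, hy]

lemma Fix.smul (r : R) (hx : Fix p s b x) : Fix p s b (r • x) := by
  rw [Fix] at *; rw [smul_comm, hx]

lemma Fix.sub (hx : Fix p s b x) (hy : Fix p s b y) : Fix p s b (x - y) := by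
  rw [Fix] at *; rw [smul_sub, hx, hy]

lemma Fix.zero : Fix p s b (0 : A) := smul_zero _

lemma Fix.sum {ι : Type*} {t : Finset ι} {f : ι → A} (h : ∀ j ∈ t, Fix p s b (f j)) :
    Fix p s b (∑ j ∈ t, f j) := by
  rw [Fix, smul_sum]
  exact sum_congr rfl h

lemma pow_sub_one_mul_relNorm (hbc : b ≤ c) :
    (s ^ p ^ b - 1) * relNorm p s b c = s ^ p ^ c - 1 := by
  rw [relNorm, sub_one_mul_geom, ← pow_mul, ← pow_add, Nat.add_sub_cancel' hbc]

lemma Fix.relNorm (hbc : b ≤ c) (h : Fix p s c x) : Fix p s b (relNorm p s b c • x) := by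
  have h1 : ((s ^ p ^ b - 1) * CyclicNorm.relNorm p s b c) • x = 0 := by
    rw [pow_sub_one_mul_relNorm hbc, sub_smul, h, one_smul, sub_self]
  rw [Fix]
  rwa [mul_smul, sub_smul, one_smul, sub_eq_zero] at h1

lemma relNorm_smul_of_fix (h : Fix p s b x) :
    relNorm p s b c • x = (p : R) ^ (c - b) • x := by
  rw [relNorm, geom_smul_of_fixed h, Nat.cast_pow]

lemma norm_mul_relNorm (hbc : b ≤ c) : norm p s b * relNorm p s b c = norm p s c := by
  rw [norm, relNorm, ← geom_mul, ← pow_add, Nat.add_sub_cancel' hbc, norm]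

lemma relNorm_mul_relNorm (hbc : b ≤ c) (hce : c ≤ e) :
    relNorm p s b c * relNorm p s c e = relNorm p s b e := by
  have h1 : p ^ c = p ^ b * p ^ (c - b) := by rw [← pow_add, Nat.add_sub_cancel' hbc]
  rw [relNorm, relNorm, h1, pow_mul, ← geom_mul, relNorm, ← pow_add]
  congr 2
  omega

lemma sub_one_mul_norm : (s - 1) * norm p s c = s ^ p ^ c - 1 := sub_one_mul_geom _ _

lemma norm_smul_of_fix (hbc : b ≤ c) (h : Fix p s b x) :
    norm p s c • x = (p : R) ^ (c - b) • norm p s b • x := by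
  rw [← norm_mul_relNorm hbc, mul_smul, relNorm_smul_of_fix h, smul_comm]

/-- The weight of the `i`-th component in the norm condition: the norm from level `n - 1` for
`i = 0`, and `p^(i-1)` times the norm from level `n` for `i ≥ 1`. -/
def wt (p : ℕ) (s : R) (n i : ℕ) : R :=
  if i = 0 then norm p s (n - 1) else (p : R) ^ (i - 1) * norm p s n

lemma wt_smul_of_fix (hcn : c ≤ n) (hi : i = 0 → c < n) (h : Fix p s c x) :
    wt p s n i • x = (p : R) ^ (i + n - 1 - c) • norm p s c • x := by
  unfold wt
  split_ifs with h0
  · have := hi h0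
    rw [norm_smul_of_fix (by omega) h]
    congr 2
    omega
  · rw [mul_smul, norm_smul_of_fix hcn h, smul_smul, ← pow_add]
    congr 2
    omega

end Operators

section Obstruction

variable {R A : Type*} [CommRing R] [AddCommGroup A] [Module R A]

/-- The properties of the unit group of a cyclic extension of degree `p^n`, written additively,
on which the analysis of norm pairs rests: Hilbert 90 and the structure of the `p`-torsion. -/
structure CyclicUnits (p n : ℕ) (s : R) (ξ : A) : Prop where
  prime : p.Prime
  pos : 0 < n
  fix (x : A) : Fix p s n x
  hilbert90 (x : A) : norm p s n • x = 0 → ∃ y : A, x = (s - 1) • y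
  ne_zero : ξ ≠ 0
  torsion : (p : R) • ξ = 0
  fixed : s • ξ = ξ
  generates (x : A) : (p : R) • x = 0 → ∃ c : ℤ, x = (c : R) • ξ

variable {p n : ℕ} {s : R} {ξ : A}

lemma norm_mul_sub_one_smul {b : ℕ} {x : A} (h : Fix p s b x) :
    norm p s b • (s - 1) • x = 0 := by
  rw [smul_smul, mul_comm, sub_one_mul_norm, sub_smul, h, one_smul, sub_self]

lemma fix_zero_iff {x : A} : Fix p s 0 x ↔ s • x = x := by simp [Fix]

lemma norm_one_smul_of_fix_zero {x : A} (h : Fix p s 0 x) : norm p s 1 • x = (p : R) • x := by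
  rw [norm_smul_of_fix (Nat.zero_le 1) h]
  simp [norm, geom]

namespace CyclicUnits

variable (H : CyclicUnits p n s ξ)
include H

lemma hilbert90_one {x : A} (hx : Fix p s 1 x) (h : norm p s 1 • x = 0) :
    ∃ y : A, Fix p s 1 y ∧ x = (s - 1) • y := by
  have hn := H.pos
  obtain ⟨y, hy⟩ := H.hilbert90 x (by rw [norm_smul_of_fix hn hx, h, smul_zero])
  refine ⟨y, ?_, hy⟩
  rw [hy, smul_smul, mul_comm, sub_one_mul_norm, sub_smul, one_smul, sub_eq_zero] at h
  exact h

lemma exists_int_smul_of_pow_smul_eq_zero {k : ℕ} {x y : A} (hy : (p : R) ^ k • y = ξ)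
    (hx : (p : R) ^ (k + 1) • x = 0) : ∃ c : ℤ, x = (c : R) • y := by
  induction k generalizing x y with
  | zero =>
    simp only [pow_zero, one_smul, zero_add, pow_one] at hx hy
    exact hy ▸ H.generates x hx
  | succ k ih =>
    obtain ⟨c, hc⟩ := H.generates ((p : R) ^ (k + 1) • x) (by rw [smul_smul, ← pow_succ', hx])
    have h1 : (p : R) ^ (k + 1) • (x - (c : R) • y) = 0 := by
      rw [smul_sub, smul_comm, hy, hc, sub_self]
    have h2 : (p : R) ^ k • (p : R) • y = ξ := by rw [smul_smul, ← pow_succ, hy]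
    obtain ⟨c', hc'⟩ := ih h2 h1
    refine ⟨c + c' * p, ?_⟩
    push_cast
    linear_combination (norm := module) hc'

lemma smul_ne_zero {u : ℤ} (hu : ¬ (p : ℤ) ∣ u) : (u : R) • ξ ≠ 0 := by
  intro h
  obtain ⟨a, b, hab⟩ := ((Nat.prime_iff_prime_int.mp H.prime).coprime_iff_not_dvd).mpr hu
  apply H.ne_zero
  have h1 : ((a * p + b * u : ℤ) : R) = 1 := by rw [hab]; simp
  push_cast at h1
  have h2 := H.torsion
  rw [← one_smul R ξ, ← h1]
  linear_combination (norm := module) (a : R) • h2 + (b : R) • h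

/-- An element of level one satisfying the norm condition with twist one modulo `p` is not
congruent to an element of the base modulo `p` and the augmentation. -/
lemma not_eq_sub_one_smul_add {α β μ f x : A} {u : ℤ} (hu : ¬ (p : ℤ) ∣ u)
    (hμ : Fix p s 1 μ) (hf : Fix p s 0 f) (hx : Fix p s 1 x)
    (hα : (s - 1) • α = (p : R) • β) (hβ : norm p s 1 • β = ξ) :
    (u : R) • α ≠ (s - 1) • μ + f + (p : R) • x := by
  intro h
  have hf' : (s - 1) • f = 0 := by rw [sub_smul, one_smul, fix_zero_iff.mp hf, sub_self]
  have hμ' := norm_mul_sub_one_smul hμ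
  have hx' := norm_mul_sub_one_smul hx
  obtain ⟨Q, hQ⟩ := sub_one_dvd_geom_sub s (p ^ 1)
  change norm p s 1 - _ = _ at hQ
  rw [pow_one] at hQ
  have hN : norm p s 1 = (p : R) + (s - 1) * Q := by linear_combination hQ
  set N := norm p s 1
  obtain ⟨β', hβ'⟩ : ∃ β' : A, β' = (u : R) • β - (s - 1) • x := ⟨_, rfl⟩
  have h1 : (s - 1) • (s - 1) • μ = (p : R) • β' := by
    rw [hβ']
    linear_combination (norm := module) (u : R) • hα - (s - 1) • h - hf'
  have h2 : N • β' = (u : R) • ξ := by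
    rw [hβ']
    linear_combination (norm := module) (u : R) • hβ - hx'
  have h3 : (s - 1) • ((s - 1) • μ + Q • β') = (u : R) • ξ := by
    rw [← h2, hN]
    linear_combination (norm := module) h1
  have h4 : (p : R) • ((s - 1) • μ + Q • β') = 0 := by
    have h5 : N • ((s - 1) • μ + Q • β') = Q • (u : R) • ξ := by
      rw [← h2]
      linear_combination (norm := module) hμ'
    rw [hN] at h5
    linear_combination (norm := module) h5 - Q • h3
  obtain ⟨c, hc⟩ := H.generates _ h4
  have h6 := H.fixed
  apply H.smul_ne_zero hu
  rw [← h3, hc]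
  linear_combination (norm := module) (c : R) • h6

lemma false_of_twist_one {k : ℕ} {α' g g' x x' : A} {u : ℤ} (hu : ¬ (p : ℤ) ∣ u)
    (hα' : Fix p s 1 α') (hg : Fix p s 0 g) (hg' : Fix p s 0 g')
    (hx : Fix p s 1 x) (hx' : Fix p s 1 x')
    (hN : (p : R) ^ (k + 1) • g + (p : R) ^ (k + 1) • norm p s 1 • x = ξ)
    (h' : (s - 1) • α' = (p : R) ^ (k + 1) • g' +
      (p : R) ^ (k + 1) • ((u : R) • α' + (p : R) • x'))
    (hN' : (p : R) ^ (k + 1) • g' +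
      (p : R) ^ k • norm p s 1 • ((u : R) • α' + (p : R) • x') = ξ) : False := by
  have hg1 := norm_one_smul_of_fix_zero hg
  have hg1' := norm_one_smul_of_fix_zero hg'
  set N := norm p s 1 with hNdef
  have hz : (p : R) ^ k • N • (g + (p : R) • x) = ξ := by
    linear_combination (norm := module) hN + (p : R) ^ k • hg1
  obtain ⟨y, hy⟩ : ∃ y : A, y = (u : R) • α' + (p : R) • x' + g' - (g + (p : R) • x) := ⟨_, rfl⟩
  have hyN : (p : R) ^ k • N • y = 0 := by
    rw [hy]
    linear_combination (norm := module) hN' + (p : R) ^ k • hg1' - hz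
  obtain ⟨c, hc⟩ := H.exists_int_smul_of_pow_smul_eq_zero hz
    (x := N • y) (by rw [pow_succ', mul_smul, hyN, smul_zero])
  have hgz : Fix p s 1 (g + (p : R) • x) := (hg.mono zero_le_one).add (hx.smul _)
  have hyf : Fix p s 1 y := by
    rw [hy]
    exact ((((hα'.smul _).add (hx'.smul _)).add (hg'.mono zero_le_one))).sub hgz
  obtain ⟨μ, hμ, hμy⟩ := H.hilbert90_one (x := y - (c : R) • (g + (p : R) • x))
    (hyf.sub (hgz.smul _)) (by rw [← hNdef, smul_sub, hc]; module)
  refine H.not_eq_sub_one_smul_add (α := α') (μ := μ)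
    (β := (p : R) ^ k • ((u : R) • α' + (p : R) • x' + g')) (f := ((c : R) + 1) • g - g')
    (x := ((c : R) + 1) • x - x') hu hμ
    ((hg.smul _).sub hg') ((hx.smul _).sub hx') ?_ ?_ ?_
  · linear_combination (norm := module) h'
  · linear_combination (norm := module) hN' + (p : R) ^ k • hg1'
  · rw [← hμy, hy]
    module

lemma false_of_twist_neg_one (hp : p = 2) {k : ℕ} {α α' g g' x x' : A} {u : ℤ}
    (hu : ¬ (p : ℤ) ∣ u)
    (hg : Fix p s 0 g) (hg' : Fix p s 0 g')
    (hx : Fix p s 1 x) (hx' : Fix p s 1 x') (hα' : Fix p s 1 α')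
    (h : (s + 1) • α = (p : R) • g + (p : R) ^ (k + 3) • x)
    (hN : -(norm p s 1 • α) + (p : R) • g + (p : R) ^ (k + 2) • norm p s 1 • x = ξ)
    (h' : (s + 1) • α' = (p : R) • g' + (p : R) ^ (k + 2) • ((u : R) • α' + (p : R) • x'))
    (hN' : -(norm p s 1 • α') + (p : R) • g' +
      (p : R) ^ (k + 1) • norm p s 1 • ((u : R) • α' + (p : R) • x') = ξ) : False := by
  have hN1 : norm p s 1 = s + 1 := by
    subst hp
    simp [norm, geom, sum_range_succ, add_comm]
  subst hp
  rw [hN1] at hN hN'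
  obtain ⟨v, rfl⟩ : ∃ v, u = 2 * v + 1 := by
    have : u % 2 = 1 := by omega
    exact ⟨u / 2, by omega⟩
  have hg1 := fix_zero_iff.mp hg
  have hg1' := fix_zero_iff.mp hg'
  have hξ := H.torsion
  have hξs := H.fixed
  simp only [Fix, pow_one] at hx hx' hα'
  push_cast at *
  have hz : (2 : R) ^ (k + 2) • (s - 1) • x = ξ := by
    linear_combination (norm := module) hN + h
  have hz' : (2 : R) ^ (k + 1) • (s - 1) • ((2 * v + 1 : R) • α' + (2 : R) • x') = ξ := by
    linear_combination (norm := module) hN' + h'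
  obtain ⟨y, hy⟩ : ∃ y : A, y = (2 * v + 1 : R) • α' + (2 : R) • x' - (2 : R) • x := ⟨_, rfl⟩
  have hy0 : (2 : R) ^ (k + 1) • (s - 1) • y = 0 := by
    rw [hy]
    linear_combination (norm := module) hz' - hz
  have hN1 : ∀ w : A, s ^ 2 • w = w → s • (s + 1) • w = (s + 1) • w := by
    intro w hw
    linear_combination (norm := module) hw
  obtain ⟨φ, hφ⟩ : ∃ φ : A, φ = (2 * v + 1 : R) • (g' +
      (2 : R) ^ k • (s + 1) • ((2 * v + 1 : R) • α' + (2 : R) • x')) +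
      (s + 1) • x' - (s + 1) • x := ⟨_, rfl⟩
  have hφs : s • φ = φ := by
    rw [hφ]
    linear_combination (norm := module) (2 * v + 1 : R) • hg1' + (hN1 x' hx') - (hN1 x hx) +
      ((2 * v + 1 : R) * 2 ^ k * (2 * v + 1)) • (hN1 α' hα') +
      ((2 * v + 1 : R) * 2 ^ k * 2) • (hN1 x' hx')
  have hNy : (s + 1) • y = (2 : R) • φ + ξ := by
    rw [hy, hφ]
    linear_combination (norm := module) -(2 * v + 1 : R) • hN' - (v + 1 : R) • hξ
  obtain ⟨c, hc⟩ := H.exists_int_smul_of_pow_smul_eq_zero (k := k + 2) (x := φ - y)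
    (y := (s - 1) • x) (by push_cast; exact hz) (by
      push_cast
      linear_combination (norm := module) -(2 : R) ^ (k + 2) • hNy + (2 : R) • hy0 -
        (2 : R) ^ (k + 1) • hξ)
  apply H.ne_zero
  have h0 : (s + 1) • (φ - y) = 0 := by
    rw [hc]
    linear_combination (norm := module) (c : R) • hx
  linear_combination (norm := module) h0 + hNy - hφs + hξ

end CyclicUnits

end Obstruction

section Representations

variable {R A : Type*} [CommRing R] [AddCommGroup A] [Module R A]

/-- Membership in the level-`a` part of the module, the level `⊥` part being trivial. -/
def Lev (p : ℕ) (s : R) (a : WithBot ℕ) (x : A) : Prop :=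
  WithBot.recBotCoe (x = 0) (fun i => Fix p s i x) a

/-- `(α, δ)` represents the norm vector `a` and the twist `1 + p * f` in length `S`. -/
structure Rep (p n : ℕ) (s : R) (ξ : A) (S : ℕ) (a : ℕ → WithBot ℕ) (f : ℤ) (α : A)
    (δ : ℕ → A) : Prop where
  lev : ∀ i < S, Lev p s (a i) (δ i)
  twist : s • α = (1 + p * f : R) • α + ∑ i ∈ range (S + 1), (p : R) ^ i • δ i
  norm : ξ = (f : R) • norm p s n • α + ∑ i ∈ range (S + 1), wt p s n i • δ i

variable {p n : ℕ} {s : R} {ξ : A}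

lemma Lev.of_coe {a : WithBot ℕ} {b : ℕ} {x : A} (h : Lev p s a x) (hab : a = b) :
    Fix p s b x := by
  subst hab; exact h

lemma Lev.of_bot {a : WithBot ℕ} {x : A} (h : Lev p s a x) (ha : a = ⊥) : x = 0 := by
  subst ha; exact h

lemma Rep.congr {S : ℕ} {a b : ℕ → WithBot ℕ} {f : ℤ} {α : A} {δ : ℕ → A}
    (h : Rep p n s ξ S a f α δ) (hab : ∀ i < S, a i = b i) : Rep p n s ξ S b f α δ :=
  ⟨fun i hi => hab i hi ▸ h.lev i hi, h.twist, h.norm⟩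

lemma Lev.zero (a : WithBot ℕ) : Lev p s a (0 : A) := by
  cases a with
  | bot => rfl
  | coe i => exact Fix.zero

lemma wt_add {m : ℕ} (hm : 0 < m) (i : ℕ) :
    wt p s n (m + i) = wt p s n m * (p : R) ^ i := by
  rw [wt, wt, if_neg (by omega), if_neg (by omega), show m + i - 1 = m - 1 + i by omega, pow_add]
  ring

lemma Rep.restrict {m S : ℕ} {a : ℕ → WithBot ℕ} {f : ℤ} {α : A} {δ : ℕ → A} (hm : 0 < m)
    (hmS : m ≤ S) (h : Rep p n s ξ S a f α δ) : ∃ δ', Rep p n s ξ m a f α δ' := by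
  obtain ⟨t, rfl⟩ := Nat.exists_eq_add_of_le hmS
  have hsum (w : ℕ → R) (hw : ∀ i, w (m + i) = w m * (p : R) ^ i) :
      ∑ i ∈ range (m + 1), w i •
        (if i < m then δ i else ∑ j ∈ range (t + 1), (p : R) ^ j • δ (m + j)) =
        ∑ i ∈ range (m + t + 1), w i • δ i := by
    rw [sum_range_succ _ m, add_assoc m t 1, sum_range_add (fun i => w i • δ i) m (t + 1),
      if_neg (lt_irrefl m), smul_sum]
    congr 1
    · exact sum_congr rfl fun i hi => by rw [if_pos (mem_range.mp hi)]
    · exact sum_congr rfl fun i _ => by rw [hw, mul_smul]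
  refine ⟨fun i => if i < m then δ i else ∑ j ∈ range (t + 1), (p : R) ^ j • δ (m + j),
    fun i hi => ?_, ?_, ?_⟩
  · simpa only [if_pos hi] using h.lev i (by omega)
  · rw [hsum _ fun i => pow_add _ _ _]
    exact h.twist
  · rw [hsum _ (wt_add hm)]
    exact h.norm

lemma Rep.extend (H : ∀ x : A, Fix p s n x) {m S : ℕ} {a : ℕ → WithBot ℕ} {f : ℤ} {α : A}
    {δ : ℕ → A} (hmS : m ≤ S) (ha : a m = n) (h : Rep p n s ξ m a f α δ) :
    ∃ δ', Rep p n s ξ S a f α δ' := by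
  have hsum (w : ℕ → R) : ∑ i ∈ range (S + 1), w i • (if i ≤ m then δ i else 0) =
      ∑ i ∈ range (m + 1), w i • δ i := by
    rw [← sum_subset (range_mono (Nat.succ_le_succ hmS))]
    · exact sum_congr rfl fun i hi => by rw [if_pos (Nat.lt_succ_iff.mp (mem_range.mp hi))]
    · intro i _ hi
      rw [if_neg (by simpa using hi), smul_zero]
  refine ⟨fun i => if i ≤ m then δ i else 0, fun i _ => ?_, ?_, ?_⟩
  · rcases lt_trichotomy i m with hi | rfl | hi
    · simpa only [if_pos hi.le] using h.lev i hi
    · rw [if_pos le_rfl, ha]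
      exact H _
    · rw [if_neg hi.not_ge]
      exact Lev.zero _
  · rw [hsum]
    exact h.twist
  · rw [hsum]
    exact h.norm

/-- A pair of a value and a norm value which splits into a part of level zero divisible by `p^r`
and a part of level one divisible by `p^(k+1)`. -/
def BaseSplit (p : ℕ) (s : R) (r k : ℕ) (y z : A) : Prop :=
  ∃ g x : A, Fix p s 0 g ∧ Fix p s 1 x ∧ y = (p : R) ^ r • g + (p : R) ^ (k + 1) • x ∧
    z = (p : R) ^ r • g + (p : R) ^ k • norm p s 1 • x

lemma BaseSplit.zero {r k : ℕ} : BaseSplit p s r k (0 : A) 0 :=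
  ⟨0, 0, Fix.zero, Fix.zero, by simp, by simp⟩

lemma BaseSplit.add {r k : ℕ} {y z y' z' : A} (h : BaseSplit p s r k y z)
    (h' : BaseSplit p s r k y' z') : BaseSplit p s r k (y + y') (z + z') := by
  obtain ⟨g, x, hg, hx, rfl, rfl⟩ := h
  obtain ⟨g', x', hg', hx', rfl, rfl⟩ := h'
  exact ⟨g + g', x + x', hg.add hg', hx.add hx', by module, by module⟩

lemma BaseSplit.sum {r k : ℕ} {ι : Type*} {t : Finset ι} {y z : ι → A}
    (h : ∀ j ∈ t, BaseSplit p s r k (y j) (z j)) :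
    BaseSplit p s r k (∑ j ∈ t, y j) (∑ j ∈ t, z j) := by
  classical
  induction t using Finset.induction_on with
  | empty => simpa using BaseSplit.zero
  | insert j t hj ih =>
    rw [sum_insert hj, sum_insert hj]
    exact (h j (mem_insert_self _ _)).add (ih fun i hi => h i (mem_insert_of_mem hi))

lemma baseSplit_of_lt {r k j : ℕ} {x : A} (hn : 0 < n) (hx : Fix p s n x) (hj : k < j) :
    BaseSplit p s r k (relNorm p s 1 n • (p : R) ^ j • x) (wt p s n j • x) := by
  obtain ⟨t, rfl⟩ : ∃ t, j = k + 1 + t := ⟨j - (k + 1), by omega⟩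
  refine ⟨0, (p : R) ^ t • relNorm p s 1 n • x, Fix.zero, (hx.relNorm hn).smul _, ?_, ?_⟩
  · rw [pow_add]; module
  · rw [wt, if_neg (by omega), ← norm_mul_relNorm (show 1 ≤ n from hn),
      show k + 1 + t - 1 = k + t by omega, pow_add]
    module

lemma baseSplit_of_fix {r k j b : ℕ} {x : A} (hx : Fix p s b x) (hb : 1 ≤ b) (hbn : b ≤ n)
    (hk : k + b < j + n) :
    BaseSplit p s r k (relNorm p s 1 n • (p : R) ^ j • x) (wt p s n j • x) := by
  obtain ⟨t, ht⟩ : ∃ t, j + (n - b) = k + 1 + t := ⟨j + n - b - (k + 1), by omega⟩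
  refine ⟨0, (p : R) ^ t • relNorm p s 1 b • x, Fix.zero, (hx.relNorm hb).smul _, ?_, ?_⟩
  · have h1 : (p : R) ^ j * (p : R) ^ (n - b) = (p : R) ^ (k + 1) * (p : R) ^ t := by
      rw [← pow_add, ht, pow_add]
    rw [← relNorm_mul_relNorm hb hbn, mul_smul, smul_comm (relNorm p s b n),
      relNorm_smul_of_fix hx, smul_smul ((p : R) ^ j), h1]
    module
  · rw [wt_smul_of_fix hbn (by omega) hx, ← norm_mul_relNorm hb,
      show j + n - 1 - b = k + t by omega, pow_add]
    module

lemma baseSplit_of_fix_zero {r k j : ℕ} {x : A} (hn : 0 < n) (hx : Fix p s 0 x)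
    (hr : r + 1 ≤ j + n) :
    BaseSplit p s r k (relNorm p s 1 n • (p : R) ^ j • x) (wt p s n j • x) := by
  obtain ⟨t, ht⟩ : ∃ t, j + (n - 1) = r + t := ⟨j + n - 1 - r, by omega⟩
  have h1 : (p : R) ^ j * (p : R) ^ (n - 1) = (p : R) ^ r * (p : R) ^ t := by
    rw [← pow_add, ht, pow_add]
  refine ⟨(p : R) ^ t • x, 0, hx.smul _, Fix.zero, ?_, ?_⟩
  · rw [smul_comm, relNorm_smul_of_fix (hx.mono zero_le_one), smul_smul, h1]
    module
  · rw [wt_smul_of_fix (Nat.zero_le n) (fun _ => hn) hx,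
      show j + n - 1 - 0 = j + (n - 1) by omega, pow_add, h1]
    simp [norm, geom, mul_smul]

lemma baseSplit_sum (H : ∀ x : A, Fix p s n x) (hn : 0 < n) {S r k : ℕ} {a : ℕ → WithBot ℕ}
    {δ : ℕ → A} (hδ : ∀ i < S, Lev p s (a i) (δ i)) (hk : k < S) (ha : ∀ i, a i ≤ n)
    (h : ∀ i ≤ k, ∀ b : ℕ, a i = b → (1 ≤ b → k + b < i + n) ∧ (b = 0 → r + 1 ≤ i + n)) :
    BaseSplit p s r k (relNorm p s 1 n • ∑ i ∈ range (S + 1), (p : R) ^ i • δ i)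
      (∑ i ∈ range (S + 1), wt p s n i • δ i) := by
  rw [smul_sum]
  refine BaseSplit.sum fun j _ => ?_
  rcases lt_or_ge k j with hkj | hjk
  · exact baseSplit_of_lt hn (H _) hkj
  have hL := hδ j (by omega)
  cases hab : a j with
  | bot => rw [hL.of_bot hab]; simpa using BaseSplit.zero
  | coe b =>
    have hbn : b ≤ n := WithBot.coe_le_coe.mp (hab ▸ ha j)
    obtain ⟨h1, h2⟩ := h j hjk b hab
    have hF := hL.of_coe hab
    rcases Nat.eq_zero_or_pos b with rfl | hb
    · exact baseSplit_of_fix_zero hn hF (h2 rfl)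
    · exact baseSplit_of_fix hF hb hbn (h1 hb)

/-- The pair consisting of a value and a norm value can be replaced by a contribution of an
element of level `b` at index `i`, up to changing the twisted element. -/
def Absorbs (p n : ℕ) (s : R) (f : ℤ) (i b : ℕ) (y z : A) : Prop :=
  ∃ ω x : A, Fix p s b ω ∧ (p : R) ^ i • ω - y = (s - (1 + p * f : R)) • x ∧
    (f : R) • norm p s n • x = 0 ∧ wt p s n i • ω = z

lemma Absorbs.zero {f : ℤ} {i b : ℕ} : Absorbs p n s f i b (0 : A) 0 :=
  ⟨0, 0, Fix.zero, by simp, by simp, by simp⟩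

lemma Absorbs.add {f : ℤ} {i b : ℕ} {y z y' z' : A} (h : Absorbs p n s f i b y z)
    (h' : Absorbs p n s f i b y' z') : Absorbs p n s f i b (y + y') (z + z') := by
  obtain ⟨ω, x, hω, h1, h2, rfl⟩ := h
  obtain ⟨ω', x', hω', h1', h2', rfl⟩ := h'
  refine ⟨ω + ω', x + x', hω.add hω', ?_, ?_, by module⟩
  · linear_combination (norm := module) h1 + h1'
  · linear_combination (norm := module) h2 + h2'

lemma Absorbs.sum {f : ℤ} {i b : ℕ} {ι : Type*} {t : Finset ι} {y z : ι → A}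
    (h : ∀ j ∈ t, Absorbs p n s f i b (y j) (z j)) :
    Absorbs p n s f i b (∑ j ∈ t, y j) (∑ j ∈ t, z j) := by
  classical
  induction t using Finset.induction_on with
  | empty => simpa using Absorbs.zero
  | insert j t hj ih =>
    rw [sum_insert hj, sum_insert hj]
    exact (h j (mem_insert_self _ _)).add (ih fun i hi => h i (mem_insert_of_mem hi))

lemma absorbs_of_fix {f : ℤ} {q : R} {i j b c : ℕ} {δ : A}
    (hq : (s - (1 + p * f : R)) * q = s ^ p ^ b - 1)
    (hqN : ∀ w : A, (f : R) • norm p s n • q • w = 0)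
    (hδ : Fix p s c δ) (hij : i ≤ j) (hcn : c ≤ n) (hbn : b ≤ n) (hi : i = 0 → b < n)
    (h : c ≤ b ∨ i + c ≤ j + b) :
    Absorbs p n s f i b ((p : R) ^ j • δ) (wt p s n j • δ) := by
  rcases le_or_gt c b with hcb | hbc
  · refine ⟨(p : R) ^ (j - i) • δ, 0, (hδ.mono hcb).smul _, ?_, by simp, ?_⟩
    · rw [smul_smul, ← pow_add, Nat.add_sub_cancel' hij]; simp
    · rw [smul_comm, wt_smul_of_fix hcn (by omega) hδ, wt_smul_of_fix hcn (by omega) hδ,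
        smul_smul, ← pow_add]
      congr 2
      omega
  · replace h : i + c ≤ j + b := by omega
    obtain ⟨Q, hQ⟩ := sub_one_dvd_geom_sub (s ^ p ^ b) (p ^ (c - b))
    change relNorm p s b c - _ = _ at hQ
    obtain ⟨t, ht⟩ : ∃ t, j = i + (c - b) + t := ⟨j - (i + (c - b)), by omega⟩
    have hω := (hδ.relNorm hbc.le).smul ((p : R) ^ t)
    refine ⟨_, q • ((p : R) ^ (i + t) * Q) • δ, hω, ?_, hqN _, ?_⟩
    · have h1 : (p : R) ^ i * (p ^ t * relNorm p s b c) - p ^ j =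
          (s - (1 + p * f : R)) * q * (p ^ (i + t) * Q) := by
        rw [hq, ht, pow_add, pow_add, pow_add]
        push_cast at hQ
        linear_combination (p : R) ^ i * p ^ t * hQ
      simp only [smul_smul, ← sub_smul]
      rw [h1]
      congr 1
      ring
    · rw [wt_smul_of_fix hbn hi hω, wt_smul_of_fix hcn (by omega) hδ, smul_comm (norm p s b),
        smul_smul (norm p s b), norm_mul_relNorm hbc.le, smul_smul, ← pow_add]
      congr 2
      omega

lemma Rep.truncate (H : ∀ x : A, Fix p s n x) {S i k b : ℕ} {a : ℕ → WithBot ℕ}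
    {f u : ℤ} {α : A} {δ : ℕ → A} {q : R}
    (hr : Rep p n s ξ S a (f + p ^ k * u) α δ)
    (hq : (s - (1 + p * f : R)) * q = s ^ p ^ b - 1)
    (hqN : ∀ w : A, (f : R) • CyclicNorm.norm p s n • q • w = 0)
    (hk : k + 1 < S) (hi : i ≤ k + 1) (hab : a i = b) (ha : ∀ j, a j ≤ n) (ha0 : a 0 < n)
    (hik : i + n ≤ k + 1 + b)
    (hj : ∀ j, i < j → j ≤ k + 1 → ∀ c : ℕ, a j = c → c ≤ b ∨ i + c ≤ j + b) :
    ∃ α' δ', Rep p n s ξ S (fun j => if j ≤ i then a j else ⊥) f α' δ' := by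
  have hbn : b ≤ n := by exact_mod_cast hab ▸ ha i
  have hi0 : i = 0 → b < n := by
    rintro rfl
    exact_mod_cast hab ▸ ha0
  have hterm : ∀ j ∈ Ico i (S + 1),
      Absorbs p n s f i b ((p : R) ^ j • δ j) (wt p s n j • δ j) := by
    intro j hjm
    rw [mem_Ico] at hjm
    rcases lt_or_ge (k + 1) j with hkj | hjk
    · exact absorbs_of_fix hq hqN (H _) hjm.1 le_rfl hbn hi0 (.inr (by omega))
    have hL := hr.lev j (by omega)
    cases hc : a j with
    | bot => rw [hL.of_bot hc]; simpa using Absorbs.zero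
    | coe c =>
      refine absorbs_of_fix hq hqN (hL.of_coe hc) hjm.1 (WithBot.coe_le_coe.mp (hc ▸ ha j))
        hbn hi0 ?_
      rcases hjm.1.eq_or_lt with rfl | hlt
      · rw [hab] at hc
        exact .inl (WithBot.coe_le_coe.mp hc.ge)
      · exact hj j hlt hjk c hc
  obtain ⟨ω, x, hω, h1, h2, h3⟩ := (Absorbs.sum hterm).add
    (absorbs_of_fix hq hqN (H ((u : R) • α)) hi le_rfl hbn hi0 (.inr hik))
  rw [show wt p s n (k + 1) = (p : R) ^ k * CyclicNorm.norm p s n from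
    if_neg (Nat.succ_ne_zero k)] at h3
  have hsplit : ∀ (w : ℕ → R), ∑ j ∈ range (S + 1),
      w j • (if j < i then δ j else if j = i then ω else 0) =
        ∑ j ∈ range i, w j • δ j + w i • ω := by
    intro w
    rw [← sum_range_add_sum_Ico _ (show i + 1 ≤ S + 1 by omega), sum_range_succ]
    have e1 : ∑ j ∈ range i, w j • (if j < i then δ j else if j = i then ω else 0) =
        ∑ j ∈ range i, w j • δ j :=
      sum_congr rfl fun j hj => by rw [if_pos (mem_range.mp hj)]
    have e2 : ∑ j ∈ Ico (i + 1) (S + 1),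
        w j • (if j < i then δ j else if j = i then ω else 0) = 0 :=
      sum_eq_zero fun j hj => by
        rw [mem_Ico] at hj
        rw [if_neg (by omega), if_neg (by omega), smul_zero]
    rw [e1, e2]
    simp
  have hT := hr.twist
  have hN := hr.norm
  rw [← sum_range_add_sum_Ico _ (show i ≤ S + 1 by omega)] at hT hN
  refine ⟨α + x, fun j => if j < i then δ j else if j = i then ω else 0, ?_, ?_, ?_⟩
  · intro j hjS
    rcases lt_trichotomy j i with h | h | h
    · simpa [h, h.le] using hr.lev j hjS
    · subst h
      simp only [le_refl, if_true, lt_irrefl, if_false, hab]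
      exact hω
    · simp [h.not_ge, h.not_gt, h.ne', Lev]
  · rw [hsplit]
    push_cast at hT
    linear_combination (norm := skip) hT - h1
    rw [pow_succ]
    module
  · rw [hsplit, h3]
    push_cast at hN
    rw [hN]
    linear_combination (norm := skip) -h2
    module

lemma Rep.exists_truncate (H : ∀ x : A, Fix p s n x) {S k b₀ : ℕ} {a : ℕ → WithBot ℕ}
    {f u : ℤ} {α : A} {δ : ℕ → A}
    (hr : Rep p n s ξ S a (f + p ^ k * u) α δ)
    (hq : ∀ b, b₀ ≤ b → ∃ q : R, (s - (1 + p * f : R)) * q = s ^ p ^ b - 1 ∧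
      ∀ w : A, (f : R) • CyclicNorm.norm p s n • q • w = 0)
    (hk : k + 1 < S) (ha : ∀ j, a j ≤ n) (ha0 : a 0 < n)
    (h : ∃ i ≤ k + 1, ∃ b : ℕ, a i = b ∧ b₀ ≤ b ∧ i + n ≤ k + 1 + b) :
    ∃ i α' δ', Rep p n s ξ S (fun j => if j ≤ i then a j else ⊥) f α' δ' := by
  classical
  have hle : ∀ (i b : ℕ), a i = b → b ≤ n := fun i b hb => by exact_mod_cast hb ▸ ha i
  have hex : ∃ v, ∃ i ≤ k + 1, ∃ b : ℕ, a i = b ∧ b₀ ≤ b ∧ i + n = v + b ∧ v ≤ k + 1 := by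
    obtain ⟨i, hi, b, hb, hb0, hk⟩ := h
    have := hle i b hb
    exact ⟨i + n - b, i, hi, b, hb, hb0, by omega, by omega⟩
  obtain ⟨i, hi, b, hb, hb0, hv, hvk⟩ := Nat.find_spec hex
  have hmin := fun v hv' => Nat.find_min hex (m := v) hv'
  set v := Nat.find hex
  obtain ⟨q, hq1, hq2⟩ := hq b hb0
  refine ⟨i, hr.truncate H hq1 hq2 hk hi hb ha ha0 (by omega) ?_⟩
  intro j hij hjk c hc
  by_contra! hcon
  have := hle j c hc
  exact hmin (j + n - c) (by omega)
    ⟨j, hjk, c, hc, by omega, by omega, by omega⟩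

lemma Rep.baseSplit (H : ∀ x : A, Fix p s n x) (hn : 0 < n) {S r k : ℕ} {a : ℕ → WithBot ℕ}
    {f : ℤ} {α : A} {δ : ℕ → A} (hr : Rep p n s ξ S a f α δ) (hk : k < S) (ha : ∀ i, a i ≤ n)
    (h : ∀ i ≤ k, ∀ b : ℕ, a i = b → (1 ≤ b → k + b < i + n) ∧ (b = 0 → r + 1 ≤ i + n)) :
    ∃ α₁ g x : A, Fix p s 1 α₁ ∧ Fix p s 0 g ∧ Fix p s 1 x ∧
      s • α₁ = (1 + p * f : R) • α₁ + (p : R) ^ r • g + (p : R) ^ (k + 1) • x ∧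
      ξ = (f : R) • CyclicNorm.norm p s 1 • α₁ + (p : R) ^ r • g +
        (p : R) ^ k • CyclicNorm.norm p s 1 • x := by
  obtain ⟨g, x, hg, hx, h1, h2⟩ := baseSplit_sum H hn hr.lev hk ha h
  refine ⟨relNorm p s 1 n • α, g, x, (H α).relNorm hn, hg, hx, ?_, ?_⟩
  · rw [smul_comm, hr.twist, smul_add, h1]
    module
  · rw [smul_smul (CyclicNorm.norm p s 1), norm_mul_relNorm hn, add_assoc, ← h2]
    exact hr.norm

namespace CyclicUnits

variable (H : CyclicUnits p n s ξ)
include H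

/-- If the twist of a longer norm pair is less divisible than that of a shorter one with the same
initial levels, then the longer one can be replaced by one with trivial twist. -/
lemma exists_rep_one {m S k : ℕ} {a : ℕ → WithBot ℕ} {u w : ℤ} {α α' : A} {δ δ' : ℕ → A}
    (hkm : k + 1 < m) (hmS : m ≤ S) (hu : ¬ (p : ℤ) ∣ u) (ha : ∀ j, a j ≤ n) (ha0 : a 0 < n)
    (hr : Rep p n s ξ m a (p ^ (k + 1) * w) α δ)
    (hr' : Rep p n s ξ S a (p ^ k * u) α' δ') :
    ∃ i α'' δ'', Rep p n s ξ S (fun j => if j ≤ i then a j else ⊥) 0 α'' δ'' := by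
  by_cases h : ∃ i ≤ k + 1, ∃ b : ℕ, a i = b ∧ 0 ≤ b ∧ i + n ≤ k + 1 + b
  · refine Rep.exists_truncate H.fix (by rwa [zero_add]) (fun b _ => ?_) (by omega) ha ha0 h
    obtain ⟨q, hq⟩ := sub_one_dvd_pow_sub_one s (p ^ b)
    exact ⟨q, by simp [hq], by simp⟩
  · exfalso
    push Not at h
    have hL : ∀ i ≤ k + 1, ∀ b : ℕ, a i = b →
        (1 ≤ b → k + 1 + b < i + n) ∧ (b = 0 → k + 1 + 1 ≤ i + n) := fun i hi b hb => by
      have := h i hi b hb (Nat.zero_le _)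
      exact ⟨fun _ => this, fun _ => by omega⟩
    obtain ⟨α₁, g, x, hα₁, hg, hx, h1, h2⟩ := hr.baseSplit H.fix H.pos hkm ha hL
    obtain ⟨α₁', g', x', hα₁', hg', hx', hy, hz⟩ :=
      hr'.baseSplit H.fix H.pos (by omega) ha hL
    push_cast at h1 h2 hy hz
    refine H.false_of_twist_one (k := k) hu hα₁' hg hg' (hx.add (hα₁.smul (w : R))) hx' ?_ ?_ ?_
    · linear_combination (norm := module) -h2
    · linear_combination (norm := module) hy
    · linear_combination (norm := module) -hz

/-- The analogue of `exists_rep_one` for twists close to `-1`. -/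
lemma exists_rep_one_or_neg_one (hp : p = 2) {m S k : ℕ} {a : ℕ → WithBot ℕ} {u w : ℤ}
    {α α' : A} {δ δ' : ℕ → A}
    (hkm : k + 2 < m) (hmS : m ≤ S) (hu : ¬ (p : ℤ) ∣ u) (ha : ∀ j, a j ≤ n) (ha0 : a 0 < n)
    (hr : Rep p n s ξ m a (-1 + p ^ (k + 2) * w) α δ)
    (hr' : Rep p n s ξ S a (-1 + p ^ (k + 1) * u) α' δ') :
    ∃ f : ℤ, (f = 0 ∨ f = -1) ∧
      ∃ i α'' δ'', Rep p n s ξ S (fun j => if j ≤ i then a j else ⊥) f α'' δ'' := by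
  by_cases h : ∃ i ≤ k + 2, ∃ b : ℕ, a i = b ∧ 1 ≤ b ∧ i + n ≤ k + 2 + b
  · refine ⟨-1, .inr rfl, Rep.exists_truncate H.fix hr' (fun b hb => ?_) (by omega) ha ha0 h⟩
    obtain ⟨t, rfl⟩ : ∃ t, b = t + 1 := ⟨b - 1, by omega⟩
    obtain ⟨q, hq⟩ := sub_one_dvd_pow_sub_one (s ^ 2) (2 ^ t)
    subst hp
    refine ⟨(s - 1) * q, ?_, fun w => ?_⟩
    · rw [pow_succ', pow_mul, hq]
      push_cast
      ring
    · rw [mul_smul, norm_mul_sub_one_smul (H.fix _), smul_zero]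
  by_cases h0 : a 0 = (0 : ℕ) ∧ n = 1
  · obtain ⟨h0, rfl⟩ := h0
    refine ⟨0, .inl rfl, 0, Rep.truncate (f := 0) (k := 0) (b := 0) (q := 1)
      (u := -1 + p ^ (k + 1) * u) H.fix (by simpa using hr') (by simp) (by simp) (by omega)
      zero_le_one h0 ha ha0 (by omega) fun j hj0 hj1 c hc => .inr ?_⟩
    have : c ≤ 1 := WithBot.coe_le_coe.mp (hc.symm.trans_le (ha j))
    omega
  · exfalso
    push Not at h
    have hL : ∀ i ≤ k + 2, ∀ b : ℕ, a i = b →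
        (1 ≤ b → k + 2 + b < i + n) ∧ (b = 0 → 1 + 1 ≤ i + n) := fun i hi b hb => by
      refine ⟨h i hi b hb, ?_⟩
      rintro rfl
      by_contra! hcon
      have hn := H.pos
      obtain rfl : i = 0 := by omega
      exact h0 ⟨hb, by omega⟩
    obtain ⟨α₁, g, x, hα₁, hg, hx, h1, h2⟩ := hr.baseSplit H.fix H.pos hkm ha hL
    obtain ⟨α₁', g', x', hα₁', hg', hx', h1', h2'⟩ :=
      hr'.baseSplit H.fix H.pos (by omega) ha hL
    subst hp
    refine H.false_of_twist_neg_one rfl (k := k) (α := α₁) hu hg hg'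
      (hx.add (hα₁.smul (w : R))) hx' hα₁' ?_ ?_ ?_ ?_
    · push_cast at h1 ⊢
      linear_combination (norm := module) h1
    · push_cast at h2 ⊢
      linear_combination (norm := module) -h2
    · push_cast at h1' ⊢
      linear_combination (norm := module) h1'
    · push_cast at h2' ⊢
      linear_combination (norm := module) -h2'

end CyclicUnits

end Representations
end CyclicNorm

/-! ### The unit group of a cyclic extension as a module -/

namespace MSS

open Finset Polynomial CyclicNorm

variable {F : Type u} {K : Type v} [Field F] [Field K] [Algebra F K]

/-- The unit group of `K`, written additively, as a module over `ℤ[X]` with `X` acting as `σ`. -/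
abbrev UnitModule (σ : K ≃ₐ[F] K) : Type v :=
  Module.AEval' (MonoidHom.toAdditive (umap σ)).toIntLinearMap

/-- The class of a unit in the module `UnitModule σ`. -/
noncomputable def toMod (σ : K ≃ₐ[F] K) (x : Kˣ) : UnitModule σ :=
  Module.AEval'.of _ (Additive.ofMul x)

section

variable (σ : K ≃ₐ[F] K)

lemma toMod_injective : Function.Injective (toMod σ) :=
  (Module.AEval'.of _).injective.comp Additive.ofMul.injective

lemma toMod_surjective : Function.Surjective (toMod σ) :=
  (Module.AEval'.of _).surjective.comp Additive.ofMul.surjective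

lemma toMod_mul (x y : Kˣ) : toMod σ (x * y) = toMod σ x + toMod σ y := by
  simp [toMod]

lemma toMod_one : toMod σ 1 = 0 := by
  simp [toMod]

lemma toMod_zpow (x : Kˣ) (k : ℤ) : toMod σ (x ^ k) = (k : ℤ[X]) • toMod σ x := by
  rw [Int.cast_smul_eq_zsmul]
  simp [toMod]

lemma toMod_pow (x : Kˣ) (k : ℕ) : toMod σ (x ^ k) = (k : ℤ[X]) • toMod σ x := by
  simpa using toMod_zpow σ x k

lemma toMod_prod {ι : Type*} (t : Finset ι) (f : ι → Kˣ) :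
    toMod σ (∏ i ∈ t, f i) = ∑ i ∈ t, toMod σ (f i) := by
  simp [toMod, ofMul_prod]

lemma toMod_umap (x : Kˣ) : toMod σ (umap σ x) = (X : ℤ[X]) • toMod σ x :=
  (Module.AEval'.X_smul_of _ _).symm

lemma umap_mul_apply (σ τ : K ≃ₐ[F] K) (x : Kˣ) : umap (σ * τ) x = umap σ (umap τ x) := by
  ext; rfl

lemma toMod_umap_pow (k : ℕ) (x : Kˣ) :
    toMod σ (umap (σ ^ k) x) = (X ^ k : ℤ[X]) • toMod σ x := by
  induction k with
  | zero =>
    rw [pow_zero, pow_zero, one_smul]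
    rfl
  | succ k ih => rw [pow_succ', pow_succ', umap_mul_apply, toMod_umap, ih, mul_smul]

lemma toMod_normHom (p j : ℕ) (x : Kˣ) :
    toMod σ (normHom p σ j x) = norm p (X : ℤ[X]) j • toMod σ x := by
  rw [normHom, MonoidHom.finsetProd_apply, toMod_prod, CyclicNorm.norm, geom, sum_smul]
  exact sum_congr rfl fun k _ => toMod_umap_pow σ k x

lemma fix_toMod_iff (p i : ℕ) (x : Kˣ) : Fix p (X : ℤ[X]) i (toMod σ x) ↔ x ∈ KiU p σ i := by
  rw [CyclicNorm.Fix, ← toMod_umap_pow, (toMod_injective σ).eq_iff, KiU, MonoidHom.mem_ker,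
    MonoidHom.div_apply, div_eq_one, MonoidHom.id_apply]

lemma lev_toMod_iff (p : ℕ) (a : WithBot ℕ) (x : Kˣ) :
    Lev p (X : ℤ[X]) a (toMod σ x) ↔ levelMem p σ a x := by
  cases a with
  | bot => exact (toMod_injective σ).eq_iff' (toMod_one σ)
  | coe i => exact fix_toMod_iff σ p i x

lemma rep_toMod_iff {p n : ℕ} (hp : p.Prime) {m : ℕ} {ξ : Kˣ} {a : Fin m → WithBot ℕ}
    {b : ℕ → WithBot ℕ} (hab : ∀ i : Fin m, b i = a i) {d f : ℤ} (hd : d = 1 + p * f)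
    {α : Kˣ} {δ : ℕ → Kˣ} :
    Rep p n (X : ℤ[X]) (toMod σ ξ) m b f (toMod σ α) (fun i => toMod σ (δ i)) ↔
      Represents p n σ ξ a d α δ := by
  have hp0 : (p : ℤ) ≠ 0 := by exact_mod_cast hp.ne_zero
  have hdf : (d - 1) / (p : ℤ) = f := by
    rw [hd, add_sub_cancel_left, Int.mul_ediv_cancel_left _ hp0]
  have h1 : (∀ i < m, Lev p (X : ℤ[X]) (b i) (toMod σ (δ i))) ↔
      ∀ i : Fin m, levelMem p σ (a i) (δ i) := by
    simp only [lev_toMod_iff]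
    exact ⟨fun h i => hab i ▸ h i i.2, fun h i hi => hab ⟨i, hi⟩ ▸ h ⟨i, hi⟩⟩
  have h2 : (X : ℤ[X]) • toMod σ α = (1 + p * f : ℤ[X]) • toMod σ α +
      ∑ i ∈ range (m + 1), (p : ℤ[X]) ^ i • toMod σ (δ i) ↔
      umap σ α = α ^ d * ∏ i ∈ range (m + 1), δ i ^ p ^ i := by
    rw [← (toMod_injective σ).eq_iff, toMod_mul, toMod_umap, toMod_zpow, toMod_prod, hd]
    simp only [toMod_pow]
    push_cast
    rfl
  have h3 : toMod σ ξ = (f : ℤ[X]) • norm p (X : ℤ[X]) n • toMod σ α +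
      ∑ i ∈ range (m + 1), wt p (X : ℤ[X]) n i • toMod σ (δ i) ↔
      ξ = normHom p σ n α ^ ((d - 1) / (p : ℤ)) * normHom p σ (n - 1) (δ 0) *
        ∏ i ∈ Icc 1 m, normHom p σ n (δ i) ^ p ^ (i - 1) := by
    rw [← (toMod_injective σ).eq_iff (a := ξ), toMod_mul, toMod_mul, toMod_zpow, toMod_prod, hdf,
      toMod_normHom, toMod_normHom, sum_range_succ', add_comm (∑ i ∈ range m, _), ← add_assoc,
      range_eq_Ico, sum_Ico_add' (fun i => wt p (X : ℤ[X]) n i • toMod σ (δ i)) 0 m 1]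
    have h4 : ∑ i ∈ Ico (0 + 1) (m + 1), wt p (X : ℤ[X]) n i • toMod σ (δ i) =
        ∑ i ∈ Icc 1 m, toMod σ (normHom p σ n (δ i) ^ p ^ (i - 1)) := by
      rw [zero_add]
      refine sum_congr rfl fun i hi => ?_
      have hi := (mem_Icc.mp hi).1
      rw [wt, if_neg (by omega), toMod_pow, toMod_normHom, mul_smul]
      push_cast
      rfl
    rw [h4, wt, if_pos rfl]
  exact ⟨fun h => ⟨h1.mp h.lev, h2.mp h.twist, h3.mp h.norm⟩,
    fun h => ⟨h1.mpr h.1, h2.mpr h.2.1, h3.mpr h.2.2⟩⟩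

/-- Hilbert 90 for the cyclic group generated by `σ`. -/
lemma exists_mul_umap_eq {σ : K ≃ₐ[F] K} (hσ : 0 < orderOf σ) {x : Kˣ}
    (hx : ∏ i ∈ range (orderOf σ), umap (σ ^ i) x = 1) : ∃ y : Kˣ, x * umap σ y = y := by
  set q := orderOf σ with hq
  let c : ℕ → Kˣ := fun k => ∏ i ∈ range k, umap (σ ^ i) x
  have hc (k : ℕ) : (c (k + 1) : K) = x * σ (c k) := by
    have h : c (k + 1) = x * umap σ (c k) := by
      simp only [c, prod_range_succ', map_prod, pow_succ', umap_mul_apply]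
      rw [mul_comm]
      rfl
    rw [h]; rfl
  have hind : LinearIndependent K (fun k : Fin q => ((σ ^ (k : ℕ) : K ≃ₐ[F] K) : K → K)) :=
    (linearIndependent_monoidHom K K).comp
      (fun k : Fin q => ((σ ^ (k : ℕ) : K ≃ₐ[F] K) : K →* K)) fun i j hij => by
        have h1 : σ ^ (i : ℕ) = σ ^ (j : ℕ) := by
          ext z; exact DFunLike.congr_fun hij z
        exact Fin.ext (pow_injOn_Iio_orderOf i.2 j.2 h1)
  obtain ⟨z, hz⟩ : ∃ z, ∑ k ∈ range q, (c k : K) * (σ ^ k) z ≠ 0 := by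
    by_contra! hcon
    refine (c 0).ne_zero (Fintype.linearIndependent_iff.mp hind (fun k => c k) ?_ ⟨0, hσ⟩)
    ext z
    simpa [sum_range] using hcon z
  refine ⟨Units.mk0 _ hz, Units.ext ?_⟩
  change (x : K) * σ (∑ k ∈ range q, (c k : K) * (σ ^ k) z) = ∑ k ∈ range q, (c k : K) * (σ ^ k) z
  have h1 : (x : K) * σ (∑ k ∈ range q, (c k : K) * (σ ^ k) z) =
      ∑ k ∈ range q, (c (k + 1) : K) * (σ ^ (k + 1)) z := by
    rw [map_sum, mul_sum]
    refine sum_congr rfl fun k _ => ?_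
    rw [hc, map_mul, mul_assoc, pow_succ', AlgEquiv.mul_apply]
  have h2 := sum_range_succ' (fun k => (c k : K) * (σ ^ k) z) q
  rw [sum_range_succ, show c q = 1 from hx, hq, pow_orderOf_eq_one, ← hq] at h2
  rw [h1]
  exact (add_right_cancel (h2.trans (by simp [c]))).symm

lemma cyclicUnits {p n : ℕ} (hp : p.Prime) (hn : 0 < n)
    {σ : K ≃ₐ[F] K} (horder : orderOf σ = p ^ n)
    {ξ : Kˣ} (hξ : IsPrimitiveRoot (ξ : K) p) (hξF : (ξ : K) ∈ Set.range (algebraMap F K)) :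
    CyclicUnits p n (X : ℤ[X]) (toMod σ ξ) where
  prime := hp
  pos := hn
  fix x := by
    obtain ⟨x, rfl⟩ := toMod_surjective σ x
    rw [CyclicNorm.Fix, ← toMod_umap_pow, ← horder, pow_orderOf_eq_one]
    rfl
  hilbert90 x hx := by
    obtain ⟨x, rfl⟩ := toMod_surjective σ x
    rw [← toMod_normHom, ← toMod_one, (toMod_injective σ).eq_iff] at hx
    rw [normHom, MonoidHom.finsetProd_apply, ← horder] at hx
    obtain ⟨y, hy⟩ := exists_mul_umap_eq (horder ▸ pow_pos hp.pos n) hx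
    refine ⟨-toMod σ y, ?_⟩
    have h2 := congrArg (toMod σ) hy
    rw [toMod_mul, toMod_umap] at h2
    linear_combination (norm := module) h2
  ne_zero h := by
    rw [← toMod_one, (toMod_injective σ).eq_iff] at h
    rw [h, Units.val_one] at hξ
    exact hp.ne_one (hξ.unique IsPrimitiveRoot.one)
  torsion := by
    rw [← toMod_pow, ← toMod_one, (toMod_injective σ).eq_iff]
    ext
    rw [Units.val_pow_eq_pow_val, hξ.pow_eq_one, Units.val_one]
  fixed := by
    rw [← toMod_umap, (toMod_injective σ).eq_iff]
    obtain ⟨z, hz⟩ := hξF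
    ext
    change σ (ξ : K) = ξ
    rw [← hz, AlgEquiv.commutes]
  generates x hx := by
    obtain ⟨x, rfl⟩ := toMod_surjective σ x
    rw [← toMod_pow, ← toMod_one, (toMod_injective σ).eq_iff] at hx
    have : NeZero p := ⟨hp.ne_zero⟩
    obtain ⟨i, -, hi⟩ := hξ.eq_pow_of_pow_eq_one (ξ := (x : K)) (by
      rw [← Units.val_pow_eq_pow_val, hx, Units.val_one])
    refine ⟨i, ?_⟩
    rw [← toMod_zpow, (toMod_injective σ).eq_iff]
    ext
    simp [hi]

end

end MSS
/-! ### Minimal norm pairs -/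

namespace MSS

open Finset Polynomial CyclicNorm

section Order

variable {m : ℕ} {a b : Fin m → WithBot ℕ}

lemma vecLT_iff_toLex_lt : vecLT a b ↔ toLex a < toLex b := Iff.rfl

lemma exists_vecLT_minimal {P : (Fin m → WithBot ℕ) → Prop} (h : ∃ a, P a) :
    ∃ a, P a ∧ ∀ b, P b → vecLT a b ∨ a = b := by
  obtain ⟨a, ha⟩ := h
  have hwf : WellFounded ((· < ·) : Lex (Fin m → WithBot ℕ) → Lex (Fin m → WithBot ℕ) → Prop) :=
    wellFounded_lt
  obtain ⟨c, hc, hmin⟩ := hwf.has_min {x | P (ofLex x)} ⟨toLex a, ha⟩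
  refine ⟨ofLex c, hc, fun b hb => ?_⟩
  rcases lt_or_eq_of_le (not_lt.mp (hmin (toLex b) hb)) with h | h
  · exact .inl h
  · exact .inr h

lemma exists_pow_dvd_maximal {D : Set ℤ} (hD : D.Nonempty) (q : ℤ) (B : ℕ) (g : ℤ → ℤ) :
    ∃ d ∈ D, ∀ d' ∈ D, ∀ i ≤ B, q ^ i ∣ g d' → q ^ i ∣ g d := by
  classical
  let v : ℤ → ℕ := fun d => Nat.findGreatest (fun i => q ^ i ∣ g d) B
  obtain ⟨d, hd, hmin⟩ := (measure fun d => B - v d).wf.has_min D hD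
  refine ⟨d, hd, fun d' hd' i hi hdvd => ?_⟩
  have h1 : i ≤ v d' := Nat.le_findGreatest hi hdvd
  have h2 : ¬ B - v d' < B - v d := hmin d' hd'
  have h3 : v d' ≤ B := Nat.findGreatest_le B
  have h4 : q ^ v d ∣ g d := Nat.findGreatest_spec (P := fun i => q ^ i ∣ g d) (Nat.zero_le B)
    (by simp)
  exact (pow_dvd_pow q (by omega)).trans h4

lemma exists_twistLE_minimal {p : ℕ} {D : Set ℤ} (hD : D.Nonempty)
    (hDp : ∀ d ∈ D, (p : ℤ) ∣ d - 1) (m : ℕ) : ∃ d ∈ D, ∀ d' ∈ D, twistLE p m d d' := by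
  by_cases h : ∃ d ∈ D, ¬ (p = 2 ∧ ¬ (4 : ℤ) ∣ d - 1)
  · obtain ⟨d, ⟨hd, hd2⟩, hmax⟩ := exists_pow_dvd_maximal
      (D := {d ∈ D | ¬ (p = 2 ∧ ¬ (4 : ℤ) ∣ d - 1)}) h p m (· - 1)
    refine ⟨d, hd, fun d' hd' => ⟨fun hs => absurd ⟨hs.1, hs.2.1⟩ hd2, fun _ i hi him hdvd => ?_⟩⟩
    by_cases hs : p = 2 ∧ ¬ (4 : ℤ) ∣ d' - 1
    · obtain ⟨rfl, h4⟩ := hs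
      have hi1 : i = 1 := by
        by_contra hne
        exact h4 ((pow_dvd_pow (2 : ℤ) (show 2 ≤ i by omega)).trans hdvd)
      rw [hi1, pow_one]
      exact hDp d hd
    · exact hmax d' ⟨hd', hs⟩ i him hdvd
  · push Not at h
    obtain ⟨d, hd, hmax⟩ := exists_pow_dvd_maximal hD 2 m (· + 1)
    exact ⟨d, hd, fun d' hd' => ⟨fun _ i _ him => hmax d' hd' i him,
      fun hs => absurd ⟨(h d hd).1, (h d hd).2, (h d' hd').2⟩ hs⟩⟩

lemma exists_lt_and_not_succ (P : ℕ → Prop) {l i : ℕ} (hli : l ≤ i) (hl : P l) (hi : ¬ P i) :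
    ∃ k, l ≤ k ∧ k < i ∧ P k ∧ ¬ P (k + 1) := by
  by_contra! h
  have key : ∀ j, l ≤ j → j ≤ i → P j := by
    intro j hj
    induction j, hj using Nat.le_induction with
    | base => exact fun _ => hl
    | succ j hj ih => exact fun hji => h j hj (by omega) (ih (by omega))
  exact hi (key i hli le_rfl)

end Order

section NormPairs

variable {F : Type u} {K : Type v} [Field F] [Field K] [Algebra F K]
variable {p n m s : ℕ} {σ : K ≃ₐ[F] K} {ξ : Kˣ}

lemma IsNormPair.exists_minimal {a : Fin m → WithBot ℕ} {d : ℤ} (h : IsNormPair p n σ ξ a d) :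
    ∃ (a' : Fin m → WithBot ℕ) (d' : ℤ), IsMinimalNormPair p n σ ξ a' d' := by
  obtain ⟨a', ⟨d₀, hd₀⟩, hmin⟩ := exists_vecLT_minimal
    (P := fun a : Fin m → WithBot ℕ => ∃ d, IsNormPair p n σ ξ a d) ⟨a, d, h⟩
  obtain ⟨d', hd', hmin'⟩ := exists_twistLE_minimal (p := p)
    (D := {d | IsNormPair p n σ ξ a' d}) ⟨d₀, hd₀⟩ (fun d hd => hd.2.2.1) m
  refine ⟨a', d', hd', fun b e hb => ?_⟩
  rcases hmin b ⟨e, hb⟩ with hlt | rfl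
  · exact .inl hlt
  · exact .inr ⟨rfl, hmin' e hb⟩

/-- The extension of a norm vector to all indices by the top level. -/
def extendVec (n : ℕ) (a : Fin m → WithBot ℕ) (j : ℕ) : WithBot ℕ :=
  if h : j < m then a ⟨j, h⟩ else n

lemma extendVec_of_lt (n : ℕ) (a : Fin m → WithBot ℕ) {j : ℕ} (h : j < m) :
    extendVec n a j = a ⟨j, h⟩ := dif_pos h

lemma extendVec_of_le (n : ℕ) (a : Fin m → WithBot ℕ) {j : ℕ} (h : m ≤ j) :
    extendVec n a j = n := dif_neg h.not_gt

lemma extendVec_le {a : Fin m → WithBot ℕ} (ha : ∀ i, a i ≤ n) (j : ℕ) : extendVec n a j ≤ n := by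
  unfold extendVec
  split_ifs
  · exact ha _
  · exact le_rfl

lemma isNormPair_iff_rep (hp : p.Prime) (hm : 0 < m) {a : Fin m → WithBot ℕ} {d : ℤ}
    {b : ℕ → WithBot ℕ} (hab : ∀ i : Fin m, b i = a i) :
    IsNormPair p n σ ξ a d ↔ (∀ i, a i ≤ n) ∧ a ⟨0, hm⟩ < n ∧
      ∃ f : ℤ, d = 1 + p * f ∧ ∃ α δ, Rep p n (X : ℤ[X]) (toMod σ ξ) m b f α δ := by
  constructor
  · rintro ⟨h1, h2, ⟨f, hf⟩, α, δ, h⟩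
    have hd : d = 1 + p * f := by linear_combination hf
    exact ⟨h1, h2 hm, f, hd, _, _, (rep_toMod_iff σ hp hab hd).mpr h⟩
  · rintro ⟨h1, h2, f, hd, α, δ, h⟩
    obtain ⟨α, rfl⟩ := toMod_surjective σ α
    choose δ' hδ' using fun i => toMod_surjective σ (δ i)
    obtain rfl : (fun i => toMod σ (δ' i)) = δ := funext hδ'
    exact ⟨h1, fun _ => h2, ⟨f, by rw [hd]; ring⟩, α, δ', (rep_toMod_iff σ hp hab hd).mp h⟩

lemma IsNormPair.restrict (hp : p.Prime) (hm : 0 < m) (hms : m ≤ s) {a : Fin s → WithBot ℕ} {d : ℤ}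
    (h : IsNormPair p n σ ξ a d) :
    IsNormPair p n σ ξ (fun j : Fin m => a (Fin.castLE hms j)) d := by
  obtain ⟨h1, h2, f, hd, α, δ, hr⟩ := (isNormPair_iff_rep hp (hm.trans_le hms)
    (b := extendVec n a) fun i => extendVec_of_lt n a i.2).mp h
  obtain ⟨δ', hr'⟩ := hr.restrict hm hms
  exact (isNormPair_iff_rep hp hm (b := extendVec n a) fun i =>
    extendVec_of_lt n a (i.2.trans_le hms)).mpr ⟨fun i => h1 (Fin.castLE hms i), h2, f, hd, α, δ', hr'⟩

lemma IsNormPair.extend (hp : p.Prime) (H : CyclicUnits p n (X : ℤ[X]) (toMod σ ξ)) (hm : 0 < m)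
    (hms : m ≤ s) {a : Fin m → WithBot ℕ} {d : ℤ} (h : IsNormPair p n σ ξ a d) :
    IsNormPair p n σ ξ (fun j : Fin s => extendVec n a j) d := by
  obtain ⟨h1, h2, f, hd, α, δ, hr⟩ := (isNormPair_iff_rep hp hm
    (b := extendVec n a) fun i => extendVec_of_lt n a i.2).mp h
  obtain ⟨δ', hr'⟩ := hr.extend H.fix hms (extendVec_of_le n a le_rfl)
  refine (isNormPair_iff_rep hp (hm.trans_le hms) (b := extendVec n a) fun i => rfl).mpr
    ⟨fun i => extendVec_le h1 _, ?_, f, hd, α, δ', hr'⟩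
  simpa only [extendVec_of_lt n a hm] using h2

/-- Lowering the levels of a minimal norm pair can only give norm pairs with a larger twist. -/
lemma IsMinimalNormPair.twistLE_of_truncate (hp : p.Prime) (hs : 0 < s) {a : Fin s → WithBot ℕ}
    {d : ℤ} (h : IsMinimalNormPair p n σ ξ a d) {i : ℕ} {f : ℤ} {α : UnitModule σ}
    {δ : ℕ → UnitModule σ}
    (hr : Rep p n (X : ℤ[X]) (toMod σ ξ) s (fun j => if j ≤ i then extendVec n a j else ⊥) f α δ) :
    twistLE p s d (1 + p * f) := by
  have hle (j : Fin s) : (if (j : ℕ) ≤ i then a j else ⊥) ≤ a j := by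
    split_ifs
    · exact le_rfl
    · exact bot_le
  have hnp : IsNormPair p n σ ξ (fun j : Fin s => if (j : ℕ) ≤ i then a j else ⊥)
      (1 + p * f) :=
    (isNormPair_iff_rep hp hs fun j => by simp only [extendVec_of_lt n a j.2]).mpr
      ⟨fun j => (hle j).trans (h.1.1 j), (hle _).trans_lt (h.1.2.1 hs), f, rfl, α, δ, hr⟩
  rcases h.2 _ _ hnp with ⟨k, -, hk⟩ | h'
  · exact absurd hk (hle k).not_gt
  · exact h'.2

variable (H : CyclicUnits p n (X : ℤ[X]) (toMod σ ξ))
include H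

lemma twistLE_of_isMinimalNormPair (hm : 0 < m) (hms : m ≤ s) {a : Fin m → WithBot ℕ}
    {a' : Fin s → WithBot ℕ} {d d' : ℤ} (h : IsNormPair p n σ ξ a d)
    (h' : IsMinimalNormPair p n σ ξ a' d') (haa : ∀ j : Fin m, a' (Fin.castLE hms j) = a j) :
    twistLE p m d' d := by
  have hp := H.prime
  have hs := hm.trans_le hms
  have hp0 : (p : ℤ) ≠ 0 := by exact_mod_cast hp.ne_zero
  obtain ⟨-, -, f, hd, α, δ, hr⟩ := (isNormPair_iff_rep hp hm (b := extendVec n a') fun i =>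
    (extendVec_of_lt n a' (i.2.trans_le hms)).trans (haa i)).mp h
  obtain ⟨hle, hlt, f', hd', α', δ', hr'⟩ := (isNormPair_iff_rep hp hs
    (b := extendVec n a') fun i => extendVec_of_lt n a' i.2).mp h'.1
  have hle' := extendVec_le hle
  have hlt' : extendVec n a' 0 < n := by rwa [extendVec_of_lt n a' hs]
  have hdvd (k : ℕ) (x : ℤ) : (p : ℤ) ^ (k + 1) ∣ p * x ↔ (p : ℤ) ^ k ∣ x := by
    rw [pow_succ', mul_dvd_mul_iff_left hp0]
  have hndvd {k : ℕ} {x : ℤ} (hx : ¬ (p : ℤ) ^ (k + 1) ∣ p ^ k * x) : ¬ (p : ℤ) ∣ x :=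
    fun hd => hx (by rw [pow_succ]; exact mul_dvd_mul_left _ hd)
  refine ⟨fun hspec i hi him hdi => ?_, fun hspec i hi him hdi => ?_⟩
  · by_contra hcon
    have hp2 := hspec.1
    have h4 : (2 : ℤ) ^ 2 ∣ d' + 1 := by
      have := hspec.2.1
      rw [hp2] at hd'
      omega
    obtain ⟨k, hk2, hki, hk, hk'⟩ := exists_lt_and_not_succ (fun i => (2 : ℤ) ^ i ∣ d' + 1)
      hi h4 hcon
    obtain ⟨k, rfl⟩ : ∃ k₀, k = k₀ + 2 := ⟨k - 2, by omega⟩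
    have e1 : d + 1 = p * (f + 1) := by rw [hd, hp2]; push_cast; ring
    have e2 : d' + 1 = p * (f' + 1) := by rw [hd', hp2]; push_cast; ring
    have hpz : (2 : ℤ) = p := by rw [hp2]; rfl
    rw [hpz, e2, hdvd] at hk hk'
    rw [hpz, e1] at hdi
    obtain ⟨u, hu⟩ := hk
    obtain ⟨w, hw⟩ := (hdvd _ _).mp ((pow_dvd_pow (p : ℤ) (show k + 2 + 1 ≤ i by omega)).trans hdi)
    obtain rfl : f = -1 + p ^ (k + 2) * w := by linear_combination hw
    obtain rfl : f' = -1 + p ^ (k + 1) * u := by linear_combination hu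
    rw [hu] at hk'
    obtain ⟨e, he, i', α'', δ'', hr''⟩ := H.exists_rep_one_or_neg_one hp2 (by omega) hms
      (hndvd hk') hle' hlt' hr hr'
    obtain ⟨t1, t2⟩ := h'.twistLE_of_truncate hp hs hr''
    subst hp2
    rcases he with rfl | rfl
    · have := t2 (by norm_num) 2 (by norm_num) (by omega) (by norm_num)
      exact hspec.2.1 this
    · have := t1 (by simpa using hspec.2.1) (k + 2 + 1) (by omega) (by omega) (by norm_num)
      rw [e2, hu] at this
      exact hk' ((hdvd _ _).mp this)
  · by_contra hcon
    obtain ⟨k, hk1, hki, hk, hk'⟩ := exists_lt_and_not_succ (fun i => (p : ℤ) ^ i ∣ d' - 1)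
      hi (show (p : ℤ) ^ 1 ∣ d' - 1 from ⟨f', by rw [hd']; ring⟩) hcon
    obtain ⟨k, rfl⟩ : ∃ k₀, k = k₀ + 1 := ⟨k - 1, by omega⟩
    rw [hd', add_sub_cancel_left] at hk hk'
    rw [hd, add_sub_cancel_left] at hdi
    rw [hdvd] at hk
    obtain ⟨u, rfl⟩ := hk
    obtain ⟨w, rfl⟩ := (hdvd _ _).mp ((pow_dvd_pow (p : ℤ) (show k + 1 + 1 ≤ i by omega)).trans hdi)
    obtain ⟨i', α'', δ'', hr''⟩ := H.exists_rep_one (by omega) hms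
      (hndvd fun h => hk' ((hdvd _ _).mpr h)) hle' hlt' hr hr'
    have := (h'.twistLE_of_truncate hp hs hr'').2 (by norm_num) (k + 1 + 1) (by omega) (by omega)
      (by norm_num)
    rw [hd', add_sub_cancel_left] at this
    exact hk' this

lemma IsMinimalNormPair.extendsNP (hm : 0 < m) (hms : m ≤ s) {a : Fin m → WithBot ℕ}
    {a' : Fin s → WithBot ℕ} {d d' : ℤ} (h : IsMinimalNormPair p n σ ξ a d)
    (h' : IsMinimalNormPair p n σ ξ a' d') : ExtendsNP p hms a d a' d' := by
  have h1 := h.2 _ _ (h'.1.restrict H.prime hm hms)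
  have h2 : vecLT (fun j : Fin m => a' (Fin.castLE hms j)) a ∨
      (fun j : Fin m => a' (Fin.castLE hms j)) = a := by
    have hext (j : Fin m) : extendVec n a (Fin.castLE hms j) = a j := extendVec_of_lt n a j.2
    rcases h'.2 _ _ (h.1.extend H.prime H hm hms) with ⟨k, hk, hlt⟩ | ⟨heq, -⟩
    · rcases lt_or_ge (k : ℕ) m with hkm | hkm
      · exact .inl ⟨⟨k, hkm⟩, fun j hj => (hk _ hj).trans (hext j),
          hlt.trans_eq (hext ⟨k, hkm⟩)⟩
      · exact .inr (funext fun j =>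
          (hk (Fin.castLE hms j) (j.2.trans_le hkm)).trans (hext j))
    · exact .inr (funext fun j => (congrFun heq _).trans (hext j))
  simp only [vecLT_iff_toLex_lt] at h2
  obtain ⟨heq, hle⟩ : a = (fun j : Fin m => a' (Fin.castLE hms j)) ∧ twistLE p m d d' := by
    refine h1.resolve_left fun hlt => ?_
    rcases h2 with h2 | h2
    · exact lt_asymm h2 (vecLT_iff_toLex_lt.mp hlt)
    · rw [h2] at hlt
      exact lt_irrefl _ (vecLT_iff_toLex_lt.mp hlt)
  have haa (j : Fin m) : a' (Fin.castLE hms j) = a j := (congrFun heq j).symm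
  exact ⟨haa, hle, twistLE_of_isMinimalNormPair H hm hms h.1 h' haa⟩

end NormPairs

end MSS

/-- **Proposition (extension/restriction of minimal norm pairs).**  For
`1 ≤ m < s`, every minimal norm pair of length `m` extends to a minimal norm
pair of length `s`, and every minimal norm pair of length `s` is the extension
of a minimal norm pair of length `m`. -/
theorem statement_5 {F : Type u} {K : Type v} [Field F] [Field K] [Algebra F K]
    [IsGalois F K] [FiniteDimensional F K]
    (p n m s : ℕ) (hp : p.Prime) (hn : 0 < n) (hm : 1 ≤ m) (hms : m < s)
    (σ : K ≃ₐ[F] K) (horder : orderOf σ = p ^ n)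
    (hgen : ∀ τ : K ≃ₐ[F] K, τ ∈ Subgroup.zpowers σ)
    (ξ : Kˣ) (hξ : IsPrimitiveRoot (ξ : K) p)
    (hξF : (ξ : K) ∈ Set.range (algebraMap F K))
    (hspecial : p = 2 → n = 1 → ∃ γ : Kˣ, MSS.normHom p σ n γ = -1) :
    (∀ (a : Fin m → WithBot ℕ) (d : ℤ), MSS.IsMinimalNormPair p n σ ξ a d →
      ∃ (a' : Fin s → WithBot ℕ) (d' : ℤ), MSS.IsMinimalNormPair p n σ ξ a' d' ∧
        MSS.ExtendsNP p hms.le a d a' d') ∧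
    (∀ (a' : Fin s → WithBot ℕ) (d' : ℤ), MSS.IsMinimalNormPair p n σ ξ a' d' →
      ∃ (a : Fin m → WithBot ℕ) (d : ℤ), MSS.IsMinimalNormPair p n σ ξ a d ∧
        MSS.ExtendsNP p hms.le a d a' d') := by
  have H := MSS.cyclicUnits hp hn horder hξ hξF
  refine ⟨fun a d h => ?_, fun a' d' h' => ?_⟩
  · obtain ⟨a', d', h'⟩ := (h.1.extend hp H hm hms.le).exists_minimal
    exact ⟨a', d', h', h.extendsNP H hm hms.le h'⟩
  · obtain ⟨a, d, h⟩ := (h'.1.restrict hp hm hms.le).exists_minimal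
    exact ⟨a, d, h, h.extendsNP H hm hms.le h'⟩
end

section
/- Assume F contains a primitive p-th root of unity ξ_p, and if p = 2 assume n > 1. Then for γ ∈ K_{n-1}^×, δ ∈ K^×, and c ∈ ℤ, the following are equivalent: (1) there exists α ∈ K^× such that (a) σ(α)·α^{-1} = γ·δ^p, (b) N_{K/F}(α) is a p-th power in K^×, and (c) σ(β)·β^{-1} = ξ_p^c for some (equivalently, for every) β ∈ K^× with β^p = N_{K/F}(α); (2) ξ_p^c = N_{K_{n-1}/F}(γ) · N_{K/F}(δ). -/
section OrbitProducts

open Finset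

variable {M : Type*} [CommGroup M]

/-- The partial orbit product `∏_{j < k} f^j(x)` of an endomorphism `f`. -/
def orbitProd (f : M →* M) (k : ℕ) (x : M) : M :=
  ∏ j ∈ range k, f^[j] x

/-- The product `∏_{k < m} ∏_{j < k} f^j(x)` of the first `m` partial orbit products. -/
def orbitProdProd (f : M →* M) (m : ℕ) (x : M) : M :=
  ∏ k ∈ range m, orbitProd f k x

variable (f : M →* M)

lemma orbitProd_succ (k : ℕ) (x : M) :
    orbitProd f (k + 1) x = orbitProd f k x * f^[k] x :=
  prod_range_succ _ _

lemma orbitProd_succ' (k : ℕ) (x : M) :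
    orbitProd f (k + 1) x = f (orbitProd f k x) * x := by
  simp [orbitProd, prod_range_succ', map_prod, Function.iterate_succ_apply']

lemma orbitProdProd_succ (m : ℕ) (x : M) :
    orbitProdProd f (m + 1) x = orbitProdProd f m x * orbitProd f m x :=
  prod_range_succ _ _

lemma orbitProd_add (i j : ℕ) (x : M) :
    orbitProd f (i + j) x = f^[i] (orbitProd f j x) * orbitProd f i x := by
  have h : f^[i] (orbitProd f j x) = ∏ k ∈ range j, f^[i + k] x := by
    induction j with
    | zero => simp [orbitProd]
    | succ j ih =>
      rw [orbitProd_succ, iterate_map_mul, ih, prod_range_succ, Function.iterate_add_apply]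
  rw [h, mul_comm, orbitProd, prod_range_add]
  rfl

lemma orbitProd_mul (k : ℕ) (x y : M) :
    orbitProd f k (x * y) = orbitProd f k x * orbitProd f k y := by
  simp [orbitProd, iterate_map_mul, prod_mul_distrib]

lemma orbitProd_pow (k : ℕ) (x : M) (r : ℕ) :
    orbitProd f k (x ^ r) = orbitProd f k x ^ r := by
  simp [orbitProd, iterate_map_pow, prod_pow]

lemma orbitProdProd_mul (m : ℕ) (x y : M) :
    orbitProdProd f m (x * y) = orbitProdProd f m x * orbitProdProd f m y := by
  simp [orbitProdProd, orbitProd_mul, prod_mul_distrib]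

lemma orbitProdProd_pow (m : ℕ) (x : M) (r : ℕ) :
    orbitProdProd f m (x ^ r) = orbitProdProd f m x ^ r := by
  simp [orbitProdProd, orbitProd_pow, prod_pow]

lemma map_orbitProdProd (m : ℕ) (x : M) :
    f (orbitProdProd f m x) * x ^ m = orbitProdProd f m x * orbitProd f m x := by
  induction m with
  | zero => simp [orbitProdProd, orbitProd]
  | succ m ih =>
    rw [orbitProdProd_succ, map_mul, orbitProd_succ', pow_succ, mul_mul_mul_comm, ih]

/-- If `f` moves `α` by `x`, then `f^k` moves `α` by the `k`-th orbit product of `x`. -/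
lemma iterate_eq_mul_orbitProd {α x : M} (h : f α = α * x) (k : ℕ) :
    f^[k] α = α * orbitProd f k x := by
  induction k with
  | zero => simp [orbitProd]
  | succ k ih =>
    rw [Function.iterate_succ_apply', ih, map_mul, h, orbitProd_succ']
    ac_rfl

lemma orbitProd_eq_pow_mul {α x : M} (h : f α = α * x) (m : ℕ) :
    orbitProd f m α = α ^ m * orbitProdProd f m x := by
  simp [orbitProd, orbitProdProd, iterate_eq_mul_orbitProd f h, prod_mul_distrib]

variable {f} {q : ℕ} {x : M}

lemma map_orbitProd_of_iterate_eq (hx : f^[q] x = x) :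
    f (orbitProd f q x) = orbitProd f q x := by
  have h := orbitProd_succ' f q x
  rw [orbitProd_succ, hx] at h
  exact (mul_right_cancel h).symm

lemma orbitProd_add_of_iterate_eq (hx : f^[q] x = x) (k : ℕ) :
    orbitProd f (q + k) x = orbitProd f q x * orbitProd f k x := by
  rw [add_comm, orbitProd_add, Function.iterate_fixed (map_orbitProd_of_iterate_eq hx)]

lemma orbitProd_mul_add_of_iterate_eq (hx : f^[q] x = x) (b k : ℕ) :
    orbitProd f (b * q + k) x = orbitProd f q x ^ b * orbitProd f k x := by
  induction b with
  | zero => simp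
  | succ b ih =>
    rw [show (b + 1) * q + k = q + (b * q + k) by ring, orbitProd_add_of_iterate_eq hx, ih,
      pow_succ', mul_assoc]

lemma orbitProd_mul_of_iterate_eq (hx : f^[q] x = x) (b : ℕ) :
    orbitProd f (b * q) x = orbitProd f q x ^ b := by
  simpa [orbitProd] using orbitProd_mul_add_of_iterate_eq hx b 0

lemma orbitProdProd_mul_of_iterate_eq (hx : f^[q] x = x) (b : ℕ) :
    orbitProdProd f (b * q) x =
      orbitProdProd f q x ^ b * orbitProd f q x ^ (q * ∑ i ∈ range b, i) := by
  induction b with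
  | zero => simp [orbitProdProd]
  | succ b ih =>
    have h : orbitProdProd f (b * q + q) x = orbitProdProd f (b * q) x *
        (orbitProd f q x ^ (q * b) * orbitProdProd f q x) := by
      simp only [orbitProdProd, prod_range_add, orbitProd_mul_add_of_iterate_eq hx,
        prod_mul_distrib, prod_const, card_range, ← pow_mul, mul_comm q]
    rw [add_one_mul, h, ih, sum_range_succ, mul_add, pow_succ, pow_add]
    ac_rfl

/-- If `f` moves `α` by `γ δ^p` with `γ` fixed by `f^q`, then the orbit product of `α` of length
`p q` has a `p`-th root which `f` moves by the product of the orbit products of `γ` and `δ`. -/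
lemma exists_pow_eq_orbitProd {p e : ℕ} (he : p * e = q * ∑ i ∈ range p, i) {α γ δ : M}
    (hγ : f^[q] γ = γ) (hα : f α = α * (γ * δ ^ p)) :
    ∃ β : M, β ^ p = orbitProd f (p * q) α ∧
      f β = β * (orbitProd f q γ * orbitProd f (p * q) δ) := by
  refine ⟨α ^ q * (orbitProdProd f q γ * orbitProd f q γ ^ e * orbitProdProd f (p * q) δ), ?_, ?_⟩
  · rw [orbitProd_eq_pow_mul f hα, orbitProdProd_mul, orbitProdProd_pow,
      orbitProdProd_mul_of_iterate_eq hγ, ← he]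
    simp only [mul_pow, ← pow_mul, mul_comm]
  · have h₁ := eq_mul_inv_of_mul_eq (map_orbitProdProd f q γ)
    have h₂ := eq_mul_inv_of_mul_eq (map_orbitProdProd f (p * q) δ)
    simp only [map_mul, map_pow, hα, h₁, h₂, map_orbitProd_of_iterate_eq hγ, mul_pow, ← pow_mul]
    have h (a g d A A' T T' z : M) :
        a * (g * d) * (A * T * g⁻¹ * z * (A' * T' * d⁻¹)) = a * (A * z * A') * (T * T') := by
      calc
        _ = a * (A * z * A') * (T * T') * (g * g⁻¹) * (d * d⁻¹) := by ac_rfl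
        _ = _ := by simp
    exact h ..

end OrbitProducts

namespace MSS

variable {F K : Type*} [Field F] [Field K] [Algebra F K]

lemma umap_pow_apply (σ : K ≃ₐ[F] K) (k : ℕ) (x : Kˣ) :
    umap (σ ^ k) x = (umap σ)^[k] x := by
  induction k with
  | zero => ext; simp [umap]
  | succ k ih =>
    rw [Function.iterate_succ_apply', ← ih, pow_succ']
    ext
    simp [umap]

lemma normHom_apply (p : ℕ) (σ : K ≃ₐ[F] K) (j : ℕ) (x : Kˣ) :
    normHom p σ j x = orbitProd (umap σ) (p ^ j) x := by
  simp [normHom, orbitProd, umap_pow_apply, MonoidHom.finsetProd_apply]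

lemma mem_KiU {p : ℕ} {σ : K ≃ₐ[F] K} {i : ℕ} {x : Kˣ} :
    x ∈ KiU p σ i ↔ (umap σ)^[p ^ i] x = x := by
  rw [KiU, MonoidHom.mem_ker, MonoidHom.div_apply, div_eq_one, umap_pow_apply, MonoidHom.id_apply]

/-- Hilbert's Theorem 90 for a generator `σ` of the automorphism group. -/
lemma exists_umap_eq_mul [FiniteDimensional F K] {p n : ℕ}
    {σ : K ≃ₐ[F] K} (horder : orderOf σ = p ^ n)
    (hgen : ∀ τ : K ≃ₐ[F] K, τ ∈ Subgroup.zpowers σ) {x : Kˣ} (hx : normHom p σ n x = 1) :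
    ∃ α : Kˣ, umap σ α = α * x := by
  have hfix : (umap σ)^[p ^ n] x = x := by
    rw [← umap_pow_apply, ← horder, pow_orderOf_eq_one]
    ext
    simp [umap]
  have hmod (i : ℕ) : orbitProd (umap σ) i x = orbitProd (umap σ) (i % p ^ n) x := by
    conv_lhs => rw [← Nat.div_add_mod' i (p ^ n)]
    rw [orbitProd_mul_add_of_iterate_eq hfix, ← normHom_apply, hx, one_pow, one_mul]
  have hcongr {i j : ℕ} (h : σ ^ i = σ ^ j) :
      orbitProd (umap σ) i x = orbitProd (umap σ) j x := by
    rw [pow_inj_mod, horder] at h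
    rw [hmod i, hmod j, h]
  choose k hk using fun τ ↦ (Submonoid.mem_powers_iff _ _).1
    (mem_powers_iff_mem_zpowers.2 (hgen τ))
  obtain ⟨α, hα⟩ := groupCohomology.isMulCoboundary₁_of_isMulCocycle₁_of_aut_to_units
    (fun τ : K ≃ₐ[F] K ↦ orbitProd (umap σ) (k τ) x) fun τ ρ ↦ by
      have h : τ • orbitProd (umap σ) (k ρ) x =
          (umap σ)^[k τ] (orbitProd (umap σ) (k ρ) x) := by
        rw [← umap_pow_apply, hk]
        rfl
      beta_reduce
      rw [h, ← orbitProd_add]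
      exact hcongr (by rw [pow_add, hk, hk, hk])
  refine ⟨α, ?_⟩
  have h : umap σ α / α = x := (hα σ).trans <|
    (hcongr (j := 1) (by rw [hk, pow_one])).trans (by simp [orbitProd])
  rw [mul_comm, ← div_eq_iff_eq_mul, h]

end MSS

universe u v

/-- **Lemma.**  Assume `ξ_p ∈ F` and, if `p = 2`, that `n > 1`.  For
`γ ∈ K_{n-1}^×`, `δ ∈ K^×`, and `c ∈ ℤ`, the following are equivalent:
(1) there is `α ∈ K^×` with `(σ-1)α = γ·δ^p`, `N_{K/F}(α)` a `p`-th power in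
`K^×`, and `(σ-1)β = ξ_p^c` for every `β` with `β^p = N_{K/F}(α)` (such `β`
exists); (2) `ξ_p^c = N_{K_{n-1}/F}(γ)·N_{K/F}(δ)`. -/
theorem statement_7 {F : Type u} {K : Type v} [Field F] [Field K] [Algebra F K]
    [IsGalois F K] [FiniteDimensional F K]
    (p n : ℕ) (hp : p.Prime) (hn : 0 < n)
    (σ : K ≃ₐ[F] K) (horder : orderOf σ = p ^ n)
    (hgen : ∀ τ : K ≃ₐ[F] K, τ ∈ Subgroup.zpowers σ)
    (ξ : Kˣ) (hξ : IsPrimitiveRoot (ξ : K) p)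
    (hξF : (ξ : K) ∈ Set.range (algebraMap F K))
    (hp2 : p = 2 → 1 < n)
    (γ : Kˣ) (hγ : γ ∈ MSS.KiU p σ (n - 1)) (δ : Kˣ) (c : ℤ) :
    (∃ α : Kˣ,
        MSS.umap σ α * α⁻¹ = γ * δ ^ p ∧
        (∃ β : Kˣ, β ^ p = MSS.normHom p σ n α) ∧
        (∀ β : Kˣ, β ^ p = MSS.normHom p σ n α →
          MSS.umap σ β * β⁻¹ = ξ ^ c)) ↔
      ξ ^ c = MSS.normHom p σ (n - 1) γ * MSS.normHom p σ n δ := by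
  have : NeZero p := ⟨hp.ne_zero⟩
  set f := MSS.umap σ with hf
  have hpn : p * p ^ (n - 1) = p ^ n := by
    rw [← pow_succ', Nat.sub_add_cancel hn]
  obtain ⟨e, he⟩ : p ∣ p ^ (n - 1) * ∑ i ∈ Finset.range p, i := by
    rcases hp.eq_two_or_odd' with h | ⟨k, hk⟩
    · exact (dvd_pow_self p (by have := hp2 h; omega)).mul_right _
    · refine Dvd.dvd.mul_left ⟨k, ?_⟩ _
      have h := Finset.sum_range_id_mul_two p
      have h2 : p - 1 = 2 * k := by omega
      rw [h2] at h
      linarith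
  have hγ' := MSS.mem_KiU.1 hγ
  have hξσ : f ξ = ξ := by
    obtain ⟨z, hz⟩ := hξF
    ext
    simp [hf, MSS.umap, ← hz]
  have hξu : IsPrimitiveRoot ξ p := IsPrimitiveRoot.coe_units_iff.1 hξ
  have key (α : Kˣ) (hα : f α = α * (γ * δ ^ p)) :
      ∃ β : Kˣ, β ^ p = MSS.normHom p σ n α ∧
        f β * β⁻¹ = MSS.normHom p σ (n - 1) γ * MSS.normHom p σ n δ := by
    obtain ⟨β, h₁, h₂⟩ := exists_pow_eq_orbitProd he.symm hγ' hα
    simp only [MSS.normHom_apply, ← hpn]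
    exact ⟨β, h₁, by rw [h₂, mul_comm, inv_mul_cancel_left]⟩
  constructor
  · rintro ⟨α, hα, -, hc⟩
    obtain ⟨β, hβ, hβσ⟩ := key α (by rw [← hα]; simp [mul_comm])
    rw [← hc β hβ, hβσ]
  · intro h
    have hN : MSS.normHom p σ n (γ * δ ^ p) = 1 := by
      rw [map_mul, map_pow, MSS.normHom_apply p σ n γ, ← hpn, orbitProd_mul_of_iterate_eq hγ',
        ← MSS.normHom_apply, ← mul_pow, ← h, ← zpow_natCast, zpow_comm, zpow_natCast,
        hξu.pow_eq_one, one_zpow]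
    obtain ⟨α, hα⟩ := MSS.exists_umap_eq_mul horder hgen hN
    obtain ⟨β₀, hβ₀, hβσ⟩ := key α hα
    refine ⟨α, by rw [hα, mul_comm, inv_mul_cancel_left], ⟨β₀, hβ₀⟩, fun β hβ ↦ ?_⟩
    have hroot : ((β / β₀ : Kˣ) : K) ^ p = 1 := by
      rw [← Units.val_pow_eq_pow_val, div_pow, hβ, hβ₀, div_self', Units.val_one]
    obtain ⟨i, -, hi⟩ := hξ.eq_pow_of_pow_eq_one hroot
    have hβeq : β = ξ ^ i * β₀ := by
      rw [← div_eq_iff_eq_mul]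
      ext
      rw [← hi, Units.val_pow_eq_pow_val]
    rw [hβeq, map_mul, map_pow, hξσ, mul_inv, mul_mul_mul_comm, mul_inv_cancel, one_mul, hβσ, h]
end

section
/- If p = 2 and n = 1, then for every m ≥ 1 and every minimal norm pair ((a_0, …, a_{m-1}), d) of length m, one has a_0 = -∞. -/
universe u v

namespace MSS

/-- Hilbert 90 for a nontrivial involution. -/
theorem exists_umap_eq_mul_s8 {F K : Type*} [Field F] [Field K] [Algebra F K]
    (σ : K ≃ₐ[F] K) (h1 : σ ≠ 1) (h2 : σ ^ 2 = 1) (β : Kˣ) (hβ : β * umap σ β = 1) :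
    ∃ α : Kˣ, umap σ α = α * β := by
  have hinv : ∀ x : K, σ (σ x) = x := fun x => by
    simpa [pow_two] using congrArg (fun τ : K ≃ₐ[F] K => τ x) h2
  have hβ' : (β : K) * σ β = 1 := by
    simpa [umap] using congrArg (Units.val) hβ
  have of_ne : ∀ x : K, x ≠ 0 → σ x = x * β → ∃ α : Kˣ, umap σ α = α * β := fun x hx h =>
    ⟨Units.mk0 x hx, Units.ext (by simpa [umap] using h)⟩
  by_cases hneg : (1 : K) + σ β = 0
  · have hσβ : σ β = -1 := by linear_combination hneg
    have hβ1 : (β : K) = -1 := by rw [hσβ] at hβ'; linear_combination -hβ'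
    obtain ⟨x, hx⟩ : ∃ x, σ x ≠ x := by
      by_contra! h
      exact h1 (AlgEquiv.ext h)
    refine of_ne (σ x - x) (sub_ne_zero.2 hx) ?_
    rw [map_sub, hinv, hβ1]
    ring
  · refine of_ne (1 + σ β) hneg ?_
    rw [map_add, map_one, hinv]
    linear_combination -hβ'

theorem normHom_two_one_apply {F K : Type*} [Field F] [Field K] [Algebra F K]
    (σ : K ≃ₐ[F] K) (γ : Kˣ) : normHom 2 σ 1 γ = γ * umap σ γ := by
  have h : umap (1 : K ≃ₐ[F] K) γ = γ := Units.ext (by simp [umap])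
  simp [normHom, Finset.prod_range_succ, h]

theorem eq_bot_of_pairLE {p m : ℕ} (hm : 0 < m) {a a' : Fin m → WithBot ℕ} {d d' : ℤ}
    (h : pairLE p a d a' d') (ha' : a' ⟨0, hm⟩ = ⊥) : a ⟨0, hm⟩ = ⊥ := by
  rcases h with ⟨k, hlt, hk⟩ | ⟨rfl, -⟩
  · rcases Nat.eq_zero_or_pos k.val with h0 | h0
    · have hk0 : k = ⟨0, hm⟩ := Fin.ext h0
      rw [hk0, ha'] at hk
      exact absurd hk not_lt_bot
    · rw [hlt ⟨0, hm⟩ h0, ha']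
  · exact ha'

/-- A unit of norm `-1` in a quadratic extension yields a norm pair with twist `1` whose
first level is `-∞`. -/
theorem isNormPair_of_norm_eq_neg_one {F K : Type*} [Field F] [Field K] [Algebra F K]
    (σ : K ≃ₐ[F] K) (horder : orderOf σ = 2) (γ : Kˣ) (hγ : normHom 2 σ 1 γ = -1)
    {m : ℕ} (hm : 0 < m) :
    IsNormPair 2 1 σ (-1 : Kˣ) (fun i : Fin m => if i.val = 0 then ⊥ else 1) 1 := by
  have h1 : σ ≠ 1 := by
    rintro rfl
    simp at horder
  have h2 : σ ^ 2 = 1 := horder ▸ pow_orderOf_eq_one σ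
  have hN : γ * umap σ γ = -1 := by rw [← normHom_two_one_apply, hγ]
  obtain ⟨α, hα⟩ := exists_umap_eq_mul_s8 σ h1 h2 (γ ^ 2) (by
    rw [map_pow, ← mul_pow, hN]
    simp)
  refine ⟨fun i => ?_, fun h0 => by simp, by simp, α, fun i => if i = 1 then γ else 1,
    fun i => ?_, ?_, ?_⟩
  · dsimp only
    split_ifs
    · exact bot_le
    · exact le_rfl
  · dsimp only
    by_cases h0 : i.val = 0
    · simp [h0, levelMem]
    · rw [if_neg h0]
      change (if i.val = 1 then γ else 1) ∈ KiU 2 σ 1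
      rw [KiU, pow_one, h2, MonoidHom.mem_ker, MonoidHom.div_apply, div_eq_one]
      exact Units.ext (by simp [umap])
  · rw [Finset.prod_eq_single 1 (fun i _ hi => by simp [hi])
      (fun h => absurd (Finset.mem_range.2 (by omega)) h)]
    simpa using hα
  · rw [Finset.prod_eq_single 1 (fun i _ hi => by simp [hi])
      (fun h => absurd (Finset.mem_Icc.2 ⟨le_rfl, hm⟩) h)]
    simp [hγ]

end MSS

/-- **Lemma.**  If `p = 2` and `n = 1` (with `-1 ∈ N_{K/F}(K^×)`), then for every
`m ≥ 1` and every minimal norm pair `((a_0,…,a_{m-1}), d)` of length `m`, one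
has `a_0 = -∞`. -/
theorem statement_8 {F : Type u} {K : Type v} [Field F] [Field K] [Algebra F K]
    [IsGalois F K] [FiniteDimensional F K]
    (σ : K ≃ₐ[F] K) (horder : orderOf σ = 2 ^ 1)
    (hgen : ∀ τ : K ≃ₐ[F] K, τ ∈ Subgroup.zpowers σ)
    (ξ : Kˣ) (hξ : IsPrimitiveRoot (ξ : K) 2)
    (hξF : (ξ : K) ∈ Set.range (algebraMap F K))
    (hnorm : ∃ γ : Kˣ, MSS.normHom 2 σ 1 γ = -1) :
    ∀ (m : ℕ) (hm : 0 < m) (a : Fin m → WithBot ℕ) (d : ℤ),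
      MSS.IsMinimalNormPair 2 1 σ ξ a d → a ⟨0, hm⟩ = ⊥ := by
  intro m hm a d hmin
  obtain ⟨γ, hγ⟩ := hnorm
  obtain rfl : ξ = -1 := Units.ext (by simpa using hξ.eq_neg_one_of_two_right)
  exact MSS.eq_bot_of_pairLE hm
    (hmin.2 _ _ (MSS.isNormPair_of_norm_eq_neg_one σ (by simpa using horder) γ hγ hm)) (by simp)
end
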